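/- arXiv:1305.6268 — 5 statements merged into one kernel-verified Lean document; each statement's English description precedes it below -/
import Mathlib

section
/- The number of elements g ∈ G with age(g) = 1 and exactly one diagonal entry equal to 1 is (n_1 − 1) + (n_2 − 1) + (n_3 − 1). -/
open Finset in
/-- Combinatorial core: weights in `[0, 1)` with integral total, vanishing identically only at
the element `e`. -/
lemma card_sum_eq_one_existsUnique_eq_zero {X : Type*} [Finite X] (e : X) (f : X → Fin 3 → ℚ)
    (h0 : ∀ x j, 0 ≤ f x j) (h1 : ∀ x j, f x j < 1)
    (hint : ∀ x, ∃ n : ℤ, ∑ j, f x j = n) (he : ∀ x, (∀ j, f x j = 0) ↔ x = e) :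
    Nat.card {x : X // (∑ j, f x j) = 1 ∧ ∃! i, f x i = 0}
      = ∑ i : Fin 3, (Nat.card {x : X // f x i = 0} - 1) := by
  classical
  have := Fintype.ofFinite X
  have key : ∀ i, Nat.card {x : X // f x i = 0} - 1 = #{x : X | f x i = 0 ∧ x ≠ e} := by
    intro i
    rw [Nat.card_eq_fintype_card, Fintype.card_subtype,
      ← card_erase_of_mem (a := e) (by simpa using (he e).2 rfl i)]
    congr 1
    ext x
    simp [and_comm]
  simp_rw [key, Nat.card_eq_fintype_card, Fintype.card_subtype, card_filter]
  rw [sum_comm]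
  refine sum_congr rfl fun x _ => ?_
  obtain ⟨n, hn⟩ := hint x
  have a0 := h0 x
  have a1 := h1 x
  by_cases hxe : x = e
  · have hz := (he x).2 hxe
    simp only [hz]
    simp [hxe]
  have hne : ¬ (f x 0 = 0 ∧ f x 1 = 0 ∧ f x 2 = 0) := fun h =>
    hxe ((he x).1 (by simpa [Fin.forall_fin_succ] using h))
  simp only [Fin.forall_fin_succ, Fin.sum_univ_three, ExistsUnique, Fin.exists_fin_succ, hxe,
    ne_eq, not_false_eq_true, and_true] at a0 a1 hn ⊢
  simp only [Fin.isValue, Fin.succ_zero_eq_one, Fin.succ_one_eq_two, IsEmpty.forall_iff,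
    and_true] at a0 a1 ⊢
  obtain ⟨p0, p1, p2⟩ := a0
  obtain ⟨q0, q1, q2⟩ := a1
  generalize f x 0 = u at *
  generalize f x 1 = v at *
  generalize f x 2 = w at *
  clear he h0 h1 hint key
  have n0 : (0 : ℚ) < n := by
    by_contra! h
    exact hne ⟨by linarith, by linarith, by linarith⟩
  have n3 : (n : ℚ) < 3 := by linarith
  norm_cast at n0 n3
  have hsum : u + v + w = 1 ∨ u + v + w = 2 := by
    rw [hn]
    norm_cast
    lia
  clear hn n0 n3
  by_cases c0 : u = 0 <;> by_cases c1 : v = 0 <;> by_cases c2 : w = 0 <;>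
    simp [c0, c1, c2] at hne hsum ⊢ <;> grind

lemma Complex.exp_two_pi_mul_I_mul_ratCast_eq_one_iff (q : ℚ) :
    Complex.exp (2 * Real.pi * Complex.I * (q : ℂ)) = 1 ↔ ∃ n : ℤ, q = n := by
  rw [Complex.exp_eq_one_iff]
  refine exists_congr fun n => ?_
  rw [mul_comm, mul_left_inj' Complex.two_pi_I_ne_zero]
  norm_cast

/-- Let `G` be a finite subgroup of `SL(3,ℂ)` consisting of diagonal
matrices, with ages defined via `g j j = exp(2πi·a g j)`, `a g j ∈ ℚ ∩ [0,1)`.  For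
`i = 1,2,3` let `K i = {g ∈ G : g i i = 1}` and `n i = |K i|`.  Then the number of
elements `g ∈ G` with `age g = 1` and exactly one diagonal entry equal to `1` equals
`(n 1 - 1) + (n 2 - 1) + (n 3 - 1)`. -/
theorem card_age_one_with_fixed_coordinate
    (G : Subgroup (Matrix.SpecialLinearGroup (Fin 3) ℂ)) [Fintype G]
    (hdiag : ∀ g ∈ G, (g : Matrix (Fin 3) (Fin 3) ℂ).IsDiag)
    (a : G → Fin 3 → ℚ)
    (ha0 : ∀ g j, 0 ≤ a g j) (ha1 : ∀ g j, a g j < 1)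
    (hrep : ∀ (g : G) (j : Fin 3),
      ((g : Matrix.SpecialLinearGroup (Fin 3) ℂ) : Matrix (Fin 3) (Fin 3) ℂ) j j
        = Complex.exp (2 * Real.pi * Complex.I * (a g j : ℂ))) :
    Nat.card {g : G // (∑ j, a g j) = 1 ∧
        (∃! i : Fin 3,
          ((g : Matrix.SpecialLinearGroup (Fin 3) ℂ) : Matrix (Fin 3) (Fin 3) ℂ) i i = 1)}
      = ∑ i : Fin 3,
          (Nat.card {g : G //
            ((g : Matrix.SpecialLinearGroup (Fin 3) ℂ) : Matrix (Fin 3) (Fin 3) ℂ) i i = 1} - 1) := by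
  have hone : ∀ (g : G) (j : Fin 3),
      ((g : Matrix.SpecialLinearGroup (Fin 3) ℂ) : Matrix (Fin 3) (Fin 3) ℂ) j j = 1
        ↔ a g j = 0 := by
    intro g j
    rw [hrep, Complex.exp_two_pi_mul_I_mul_ratCast_eq_one_iff]
    refine ⟨fun ⟨n, hn⟩ => ?_, fun h => ⟨0, by simpa using h⟩⟩
    have h0 := ha0 g j
    have h1 := ha1 g j
    rw [hn] at h0 h1 ⊢
    norm_cast at h0 h1 ⊢
    lia
  simp_rw [hone]
  refine card_sum_eq_one_existsUnique_eq_zero 1 a ha0 ha1 (fun g => ?_) (fun g => ?_)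
  · rw [← Complex.exp_two_pi_mul_I_mul_ratCast_eq_one_iff, Rat.cast_sum, Finset.mul_sum,
      Complex.exp_sum, ← g.1.2]
    simp_rw [← hrep]
    conv_rhs => rw [← (hdiag g g.2).diagonal_diag, Matrix.det_diagonal]
    rfl
  · simp_rw [← hone]
    refine ⟨fun h => ?_, fun h j => by simp [h]⟩
    ext i j
    by_cases hij : i = j
    · subst hij
      simpa using h i
    · simpa [hij] using hdiag g g.2 hij
end

section
/- The element δ_0 := δ_{μ'} − δ_1 satisfies ⟨δ_0, x⟩ = 0 for every x ∈ M(γ'), i.e. δ_0 lies in the radical of the lattice M(γ'). Moreover, if Δ := γ'_1γ'_2γ'_3 − γ'_2γ'_3 − γ'_1γ'_3 − γ'_1γ'_2 > 0, then the radical of the induced bilinear form on M(γ') ⊗ ℚ is one-dimensional, spanned by δ_{μ'} − δ_1. -/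
/-!  The lattice `M(γ')` spanned by Gabrielov's weakly distinguished basis
`δ₁, δ^i_j (i = 1,2,3, 1 ≤ j ≤ γ'_i - 1), δ_{μ'}` for the cusp singularity
`x₁^{γ'₁} + x₂^{γ'₂} + x₃^{γ'₃} - c·x₁x₂x₃`.  The index `Sum.inl ()` stands for `δ₁`,
`Sum.inr (Sum.inl ⟨i, j⟩)` for `δ^i_{j+1}`, and `Sum.inr (Sum.inr ())` for `δ_{μ'}`. -/

/-- Index set of the basis `δ₁, δ^i_j, δ_{μ'}` of `M(γ')`. -/
abbrev CuspIdx (γ : Fin 3 → ℕ) : Type :=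
  Unit ⊕ ((Σ i : Fin 3, Fin (γ i - 1)) ⊕ Unit)

/-- Gram matrix of the bilinear form on `M(γ')` in the basis `δ₁, δ^i_j, δ_{μ'}`. -/
def cuspGram (γ : Fin 3 → ℕ) : CuspIdx γ → CuspIdx γ → ℤ
  | Sum.inl _, Sum.inl _ => -2
  | Sum.inl _, Sum.inr (Sum.inr _) => -2
  | Sum.inr (Sum.inr _), Sum.inl _ => -2
  | Sum.inr (Sum.inr _), Sum.inr (Sum.inr _) => -2
  | Sum.inl _, Sum.inr (Sum.inl ⟨_, j⟩) => if j.val = 0 then 1 else 0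
  | Sum.inr (Sum.inl ⟨_, j⟩), Sum.inl _ => if j.val = 0 then 1 else 0
  | Sum.inr (Sum.inr _), Sum.inr (Sum.inl ⟨_, j⟩) => if j.val = 0 then 1 else 0
  | Sum.inr (Sum.inl ⟨_, j⟩), Sum.inr (Sum.inr _) => if j.val = 0 then 1 else 0
  | Sum.inr (Sum.inl ⟨i, j⟩), Sum.inr (Sum.inl ⟨i', j'⟩) =>
      if i = i' then
        (if j.val = j'.val then -2
         else if j.val + 1 = j'.val ∨ j'.val + 1 = j.val then 1 else 0)
      else 0

/-- The bilinear form on the lattice `M(γ') = (CuspIdx γ → ℤ)`. -/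
def cuspFormZ (γ : Fin 3 → ℕ) (x y : CuspIdx γ → ℤ) : ℤ :=
  ∑ p : CuspIdx γ, ∑ q : CuspIdx γ, x p * y q * cuspGram γ p q

/-- The induced bilinear form on `M(γ') ⊗ ℚ = (CuspIdx γ → ℚ)`. -/
def cuspFormQ (γ : Fin 3 → ℕ) (x y : CuspIdx γ → ℚ) : ℚ :=
  ∑ p : CuspIdx γ, ∑ q : CuspIdx γ, x p * y q * (cuspGram γ p q : ℚ)

/-- `δ₀ := δ_{μ'} - δ₁` in the lattice `M(γ')`. -/
def cuspDelta0Z (γ : Fin 3 → ℕ) : CuspIdx γ → ℤ :=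
  Pi.single (Sum.inr (Sum.inr ())) 1 - Pi.single (Sum.inl ()) 1

/-- `δ₀ := δ_{μ'} - δ₁` in `M(γ') ⊗ ℚ`. -/
def cuspDelta0Q (γ : Fin 3 → ℕ) : CuspIdx γ → ℚ :=
  Pi.single (Sum.inr (Sum.inr ())) 1 - Pi.single (Sum.inl ()) 1

/-- The rows of the Gram matrix at `δ_{μ'}` and `δ₁` agree. -/
theorem cuspGram_last_eq_first (γ : Fin 3 → ℕ) (q : CuspIdx γ) :
    cuspGram γ (Sum.inr (Sum.inr ())) q = cuspGram γ (Sum.inl ()) q := by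
  rcases q with _ | ⟨i, j⟩ | _ <;> rfl

theorem cuspFormZ_delta0 (γ : Fin 3 → ℕ) (x : CuspIdx γ → ℤ) :
    cuspFormZ γ (cuspDelta0Z γ) x = 0 := by
  unfold cuspFormZ
  rw [Finset.sum_comm]
  refine Finset.sum_eq_zero fun q _ => ?_
  simp [cuspDelta0Z, Fintype.sum_sum_type, Pi.single_apply, cuspGram_last_eq_first]

theorem cuspFormQ_smul_delta0 (γ : Fin 3 → ℕ) (c : ℚ) (x : CuspIdx γ → ℚ) :
    cuspFormQ γ (c • cuspDelta0Q γ) x = 0 := by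
  unfold cuspFormQ
  rw [Finset.sum_comm]
  refine Finset.sum_eq_zero fun q _ => ?_
  simp [cuspDelta0Q, Fintype.sum_sum_type, Pi.single_apply, cuspGram_last_eq_first]

theorem cuspDelta0Q_ne_zero (γ : Fin 3 → ℕ) : cuspDelta0Q γ ≠ 0 := fun h => by
  simpa [cuspDelta0Q] using congrFun h (Sum.inr (Sum.inr ()))

theorem cuspFormQ_single (γ : Fin 3 → ℕ) (x : CuspIdx γ → ℚ) (q : CuspIdx γ) :
    cuspFormQ γ x (Pi.single q 1) = ∑ p, x p * (cuspGram γ p q : ℚ) := by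
  simp [cuspFormQ, Pi.single_apply]

/-- The coefficients of `x` along the `i`-th arm, extended by `x(δ₁) + x(δ_{μ'})` at the
centre and by zero beyond the end of the arm. -/
def cuspArm (γ : Fin 3 → ℕ) (x : CuspIdx γ → ℚ) (i : Fin 3) : ℕ → ℚ
  | 0 => x (Sum.inl ()) + x (Sum.inr (Sum.inr ()))
  | k + 1 => if h : k < γ i - 1 then x (Sum.inr (Sum.inl ⟨i, ⟨k, h⟩⟩)) else 0

theorem cuspArm_succ (γ : Fin 3 → ℕ) (x : CuspIdx γ → ℚ) (i : Fin 3) (j : Fin (γ i - 1)) :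
    cuspArm γ x i (j + 1) = x (Sum.inr (Sum.inl ⟨i, j⟩)) := by
  simp [cuspArm]

theorem cuspArm_end (γ : Fin 3 → ℕ) (x : CuspIdx γ → ℚ) {i : Fin 3} (h : 2 ≤ γ i) :
    cuspArm γ x i (γ i) = 0 := by
  obtain ⟨m, hm⟩ : ∃ m, γ i = m + 1 := ⟨γ i - 1, by omega⟩
  rw [hm]
  simp [cuspArm, hm]

/-- Summing a function on a path against the Cartan-type weights picks out its second
difference. -/
theorem sum_path_weights (n : ℕ) (f : ℕ → ℚ) (hf : f (n + 1) = 0) {j : ℕ} (hj : j < n) :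
    ∑ k : Fin n, f (k + 1) * (if k.val = j then -2
      else if k.val + 1 = j ∨ j + 1 = k.val then 1 else 0) =
      f (j + 2) - 2 * f (j + 1) + if j = 0 then 0 else f j := by
  rw [Fin.sum_univ_eq_sum_range (fun k => f (k + 1) * (if k = j then (-2 : ℚ)
      else if k + 1 = j ∨ j + 1 = k then 1 else 0)) n]
  have hsplit : ∀ k, f (k + 1) * (if k = j then (-2 : ℚ)
      else if k + 1 = j ∨ j + 1 = k then 1 else 0) =
      (if k = j + 1 then f (k + 1) else 0) + (if k = j then -2 * f (k + 1) else 0) +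
      (if k + 1 = j then f (k + 1) else 0) := by
    intro k
    grind
  simp only [hsplit, Finset.sum_add_distrib, Finset.sum_ite_eq', Finset.mem_range, if_pos hj]
  have h1 : (if j + 1 < n then f (j + 1 + 1) else 0) = f (j + 2) := by
    split_ifs with h
    · rfl
    · rw [show j + 2 = n + 1 by omega, hf]
  have h2 : (∑ k ∈ Finset.range n, if k + 1 = j then f (k + 1) else 0) =
      if j = 0 then 0 else f j := by
    rcases j with _ | m
    · simp
    · simp [show m < n by omega]
  rw [h1, h2]
  ring

/-- Pairing with `δ^i_{j+1}` is the second difference along the `i`-th arm. -/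
theorem cuspFormQ_arm (γ : Fin 3 → ℕ) (x : CuspIdx γ → ℚ) {i : Fin 3} (h : 2 ≤ γ i)
    (j : Fin (γ i - 1)) :
    cuspFormQ γ x (Pi.single (Sum.inr (Sum.inl ⟨i, j⟩)) 1) =
      cuspArm γ x i (j + 2) - 2 * cuspArm γ x i (j + 1) + cuspArm γ x i j := by
  have hend : cuspArm γ x i (γ i - 1 + 1) = 0 := by
    rw [Nat.sub_add_cancel (by omega)]
    exact cuspArm_end γ x h
  have hs := sum_path_weights (γ i - 1) (cuspArm γ x i) hend j.isLt
  have hother : ∀ i' : Fin 3, i' ≠ i → ∑ k : Fin (γ i' - 1), x (Sum.inr (Sum.inl ⟨i', k⟩)) *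
      (cuspGram γ (Sum.inr (Sum.inl ⟨i', k⟩)) (Sum.inr (Sum.inl ⟨i, j⟩)) : ℚ) = 0 := by
    intro i' hi
    simp [cuspGram, hi]
  have harm : ∑ k : Fin (γ i - 1), x (Sum.inr (Sum.inl ⟨i, k⟩)) *
      (cuspGram γ (Sum.inr (Sum.inl ⟨i, k⟩)) (Sum.inr (Sum.inl ⟨i, j⟩)) : ℚ) =
      cuspArm γ x i (j + 2) - 2 * cuspArm γ x i (j + 1) +
        if j.val = 0 then 0 else cuspArm γ x i j := by
    rw [← hs]
    refine Finset.sum_congr rfl fun k _ => ?_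
    rw [cuspArm_succ]
    simp only [cuspGram, if_true]
    push_cast
    rfl
  rw [cuspFormQ_single, Fintype.sum_sum_type, Fintype.sum_sum_type, Fintype.sum_sigma,
    Fintype.sum_eq_single i hother, harm]
  by_cases h0 : j.val = 0
  · simp [cuspGram, h0, cuspArm]
    ring
  · simp [cuspGram, h0]

/-- Pairing with `δ₁`. -/
theorem cuspFormQ_center (γ : Fin 3 → ℕ) (hγ : ∀ i, 2 ≤ γ i) (x : CuspIdx γ → ℚ) :
    cuspFormQ γ x (Pi.single (Sum.inl ()) 1) =
      ∑ i, cuspArm γ x i 1 - 2 * (x (Sum.inl ()) + x (Sum.inr (Sum.inr ()))) := by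
  have harm : ∀ i : Fin 3, ∑ k : Fin (γ i - 1), x (Sum.inr (Sum.inl ⟨i, k⟩)) *
      (cuspGram γ (Sum.inr (Sum.inl ⟨i, k⟩)) (Sum.inl ()) : ℚ) = cuspArm γ x i 1 := by
    intro i
    have hpos : 0 < γ i - 1 := by have := hγ i; omega
    rw [Fintype.sum_eq_single ⟨0, hpos⟩]
    · simp [cuspGram, cuspArm, hpos]
    · intro k hk
      have : k.val ≠ 0 := fun h => hk (Fin.ext h)
      simp [cuspGram, this]
  rw [cuspFormQ_single, Fintype.sum_sum_type, Fintype.sum_sum_type, Fintype.sum_sigma]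
  simp only [harm]
  simp [cuspGram]
  ring

/-- A sequence whose second differences vanish up to `n` is affine up to `n`. -/
theorem eq_affine_of_second_difference_eq_zero (f : ℕ → ℚ) (n : ℕ)
    (h : ∀ k, k + 2 ≤ n → f (k + 2) - 2 * f (k + 1) + f k = 0) :
    ∀ k ≤ n, f k = f 0 + k * (f 1 - f 0) := by
  intro k
  induction k using Nat.twoStepInduction with
  | zero => simp
  | one => simp
  | more k ih1 ih2 =>
    intro hk
    have e0 := ih1 (by omega)
    have e1 := ih2 (by omega)
    have e := h k hk
    push_cast at *
    linear_combination e + 2 * e1 - e0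

theorem exists_smul_delta0_of_radical (γ : Fin 3 → ℕ) (hγ : ∀ i, 2 ≤ γ i)
    (hΔ : (γ 0 : ℤ) * γ 1 * γ 2 - (γ 1 : ℤ) * γ 2 - (γ 0 : ℤ) * γ 2 - (γ 0 : ℤ) * γ 1 > 0)
    (x : CuspIdx γ → ℚ) (hx : ∀ y, cuspFormQ γ x y = 0) :
    ∃ c : ℚ, x = c • cuspDelta0Q γ := by
  set s : ℚ := x (Sum.inl ()) + x (Sum.inr (Sum.inr ())) with hs
  have haff : ∀ i, ∀ k ≤ γ i, cuspArm γ x i k = s + k * (cuspArm γ x i 1 - s) := fun i =>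
    eq_affine_of_second_difference_eq_zero (cuspArm γ x i) (γ i) fun k hk => by
      rw [← cuspFormQ_arm γ x (hγ i) ⟨k, by omega⟩]
      exact hx _
  have hend : ∀ i, s + γ i * (cuspArm γ x i 1 - s) = 0 := fun i => by
    rw [← haff i _ le_rfl, cuspArm_end γ x (hγ i)]
  have hc := cuspFormQ_center γ hγ x
  rw [hx, Fin.sum_univ_three, ← hs] at hc
  have hΔ' : (γ 0 : ℚ) * γ 1 * γ 2 - (γ 1 : ℚ) * γ 2 - (γ 0 : ℚ) * γ 2 - (γ 0 : ℚ) * γ 1 > 0 := by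
    exact_mod_cast hΔ
  have hs0 : s = 0 := by
    refine (mul_eq_zero.mp ?_).resolve_left hΔ'.ne'
    linear_combination -(γ 0 : ℚ) * γ 1 * γ 2 * hc - (γ 1 : ℚ) * γ 2 * hend 0
      - (γ 0 : ℚ) * γ 2 * hend 1 - (γ 0 : ℚ) * γ 1 * hend 2
  have hd : ∀ i, cuspArm γ x i 1 = 0 := fun i => by
    have hpos : (γ i : ℚ) ≠ 0 := by
      have := hγ i
      exact_mod_cast (by omega : γ i ≠ 0)
    simpa [hs0, hpos] using hend i
  refine ⟨x (Sum.inr (Sum.inr ())), ?_⟩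
  funext q
  rcases q with _ | ⟨i, j⟩ | _
  · simp [cuspDelta0Q]
    linarith
  · rw [← cuspArm_succ γ x i j, haff i _ (by omega), hd i, hs0]
    simp [cuspDelta0Q]
  · simp [cuspDelta0Q]

/-- `δ₀ = δ_{μ'} - δ₁` lies in the radical of the lattice `M(γ')`, and if
`Δ = γ'₁γ'₂γ'₃ - γ'₂γ'₃ - γ'₁γ'₃ - γ'₁γ'₂ > 0`, then the radical of the induced bilinear
form on `M(γ') ⊗ ℚ` is one-dimensional, spanned by `δ_{μ'} - δ₁`. -/
theorem cusp_radical_spanned_by_delta0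
    (γ : Fin 3 → ℕ) (hγ : ∀ i, 2 ≤ γ i) :
    (∀ x : CuspIdx γ → ℤ, cuspFormZ γ (cuspDelta0Z γ) x = 0) ∧
    ((γ 0 : ℤ) * γ 1 * γ 2 - (γ 1 : ℤ) * γ 2 - (γ 0 : ℤ) * γ 2 - (γ 0 : ℤ) * γ 1 > 0 →
      cuspDelta0Q γ ≠ 0 ∧
      ∀ x : CuspIdx γ → ℚ,
        (∀ y : CuspIdx γ → ℚ, cuspFormQ γ x y = 0) ↔ ∃ c : ℚ, x = c • cuspDelta0Q γ) := by
  refine ⟨cuspFormZ_delta0 γ, fun hΔ => ⟨cuspDelta0Q_ne_zero γ, fun x =>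
    ⟨exists_smul_delta0_of_radical γ hγ hΔ x, ?_⟩⟩⟩
  rintro ⟨c, rfl⟩ y
  exact cuspFormQ_smul_delta0 γ c y
end

section
/- For every g, h ∈ G: (i) ρ(g) preserves the bilinear form, i.e. ⟨ρ(g)(x), ρ(g)(y)⟩_V = ⟨x,y⟩_V for all x, y ∈ L(γ'); and (ii) ρ(g)∘ρ(h) = ρ(g+h) and ρ(0) = id, so that ρ defines an action of G on L(γ') by isometries. -/
/-!  The module `L(γ') ⊗ ℚ` with basis `δ₀, δ₁, δ^i_j (i = 1,2,3, 1 ≤ j ≤ γ'_i - 1)` and the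
action `ρ` of a diagonal symmetry group `G ⊆ (ℤ/γ'₁) × (ℤ/γ'₂) × (ℤ/γ'₃)` in `SL(3,ℂ)` on it.
The index `Sum.inl ()` stands for `δ₀`, `Sum.inr (Sum.inl ())` for `δ₁` and
`Sum.inr (Sum.inr ⟨i, j⟩)` for `δ^i_{j+1}`. -/

/-- Index set of the basis `δ₀, δ₁, δ^i_j` of `L(γ')`. -/
abbrev MilnorIdx (γ : Fin 3 → ℕ) : Type :=
  Unit ⊕ (Unit ⊕ (Σ i : Fin 3, Fin (γ i - 1)))

/-- Gram matrix of the bilinear form `⟨-,-⟩_V` on `L(γ')`. -/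
def milnorGram (γ : Fin 3 → ℕ) : MilnorIdx γ → MilnorIdx γ → ℚ
  | Sum.inl _, _ => 0
  | _, Sum.inl _ => 0
  | Sum.inr (Sum.inl _), Sum.inr (Sum.inl _) => -2
  | Sum.inr (Sum.inl _), Sum.inr (Sum.inr ⟨_, j⟩) => if j.val = 0 then 1 else 0
  | Sum.inr (Sum.inr ⟨_, j⟩), Sum.inr (Sum.inl _) => if j.val = 0 then 1 else 0
  | Sum.inr (Sum.inr ⟨i, j⟩), Sum.inr (Sum.inr ⟨i', j'⟩) =>
      if i = i' then
        (if j.val = j'.val then -2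
         else if j.val + 1 = j'.val ∨ j'.val + 1 = j.val then 1 else 0)
      else 0

/-- The bilinear form `⟨-,-⟩_V` on `L(γ') ⊗ ℚ = (MilnorIdx γ → ℚ)`. -/
def milnorForm (γ : Fin 3 → ℕ) (x y : MilnorIdx γ → ℚ) : ℚ :=
  ∑ p : MilnorIdx γ, ∑ q : MilnorIdx γ, x p * y q * milnorGram γ p q

/-- `δ₀`. -/
def mDelta0 (γ : Fin 3 → ℕ) : MilnorIdx γ → ℚ := Pi.single (Sum.inl ()) 1
/-- `δ₁`. -/
def mDelta1 (γ : Fin 3 → ℕ) : MilnorIdx γ → ℚ := Pi.single (Sum.inr (Sum.inl ())) 1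
/-- `δ^i_{j+1}`, for `j : Fin (γ i - 1)`. -/
def mDeltaMid (γ : Fin 3 → ℕ) (i : Fin 3) (j : Fin (γ i - 1)) : MilnorIdx γ → ℚ :=
  Pi.single (Sum.inr (Sum.inr ⟨i, j⟩)) 1

/-- The extended element `δ^i_{γ'_i} := δ₀ - Σ_{k=1}^{γ'_i-1} δ^i_k`. -/
def mDeltaExt (γ : Fin 3 → ℕ) (i : Fin 3) : MilnorIdx γ → ℚ :=
  mDelta0 γ - ∑ j : Fin (γ i - 1), mDeltaMid γ i j

/-- `δ^i_j` for `j ∈ ℤ/γ'_iℤ` represented by `j : Fin (γ i)`. -/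
def mDeltaCyc (γ : Fin 3 → ℕ) (i : Fin 3) (j : Fin (γ i)) : MilnorIdx γ → ℚ :=
  if h : j.val = 0 then mDeltaExt γ i
  else mDeltaMid γ i ⟨j.val - 1, by have := j.isLt; omega⟩

/-- `δ^i_m` for an arbitrary integer (natural number) index `m`, extended `γ'_i`-periodically. -/
def mDeltaNat (γ : Fin 3 → ℕ) (i : Fin 3) (m : ℕ) : MilnorIdx γ → ℚ :=
  if h : 0 < γ i then mDeltaCyc γ i ⟨m % γ i, Nat.mod_lt m h⟩ else 0

/-- The age `a₁(g)/γ'₁ + a₂(g)/γ'₂ + a₃(g)/γ'₃` of `g ∈ (ℤ/γ'₁) × (ℤ/γ'₂) × (ℤ/γ'₃)`. -/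
def ageQ (γ : Fin 3 → ℕ) (g : ∀ i, ZMod (γ i)) : ℚ :=
  ∑ i, ((g i).val : ℚ) / (γ i : ℚ)

/-- The image of the basis elements of `L(γ')` under `ρ(g)`:  `ρ(g)(δ₀) = δ₀`,
`ρ(g)(δ₁) = δ₁ + Σ_{i=1}^3 Σ_{j=1}^{a_i(g)} δ^i_j - age(g)·δ₀` and
`ρ(g)(δ^i_j) = δ^i_{j+a_i(g)}`. -/
def rhoImg (γ : Fin 3 → ℕ) (g : ∀ i, ZMod (γ i)) : MilnorIdx γ → (MilnorIdx γ → ℚ)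
  | Sum.inl _ => mDelta0 γ
  | Sum.inr (Sum.inl _) =>
      mDelta1 γ + (∑ i : Fin 3, ∑ j ∈ Finset.range ((g i).val), mDeltaNat γ i (j + 1))
        - ageQ γ g • mDelta0 γ
  | Sum.inr (Sum.inr ⟨i, j⟩) => mDeltaNat γ i (j.val + 1 + (g i).val)

/-- The linear extension `ρ(g) : L(γ') ⊗ ℚ → L(γ') ⊗ ℚ`. -/
def rho (γ : Fin 3 → ℕ) (g : ∀ i, ZMod (γ i)) (x : MilnorIdx γ → ℚ) : MilnorIdx γ → ℚ :=
  ∑ p : MilnorIdx γ, x p • rhoImg γ g p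

namespace MilnorLattice

open Finset

variable {γ : Fin 3 → ℕ}

/-- The form `⟨-,-⟩_V` as a bilinear map. -/
noncomputable def bilin (γ : Fin 3 → ℕ) : LinearMap.BilinForm ℚ (MilnorIdx γ → ℚ) :=
  Matrix.toBilin' (Matrix.of (milnorGram γ))

/-- `ρ(g)` as a linear map. -/
noncomputable def rhoLin (γ : Fin 3 → ℕ) (g : ∀ i, ZMod (γ i)) :
    (MilnorIdx γ → ℚ) →ₗ[ℚ] (MilnorIdx γ → ℚ) :=
  Fintype.linearCombination ℚ (rhoImg γ g)

/-- The indicator of `m ≡ n` modulo `c`. -/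
def modInd (c m n : ℕ) : ℚ := if m % c = n % c then 1 else 0

lemma milnorForm_eq_bilin (x y : MilnorIdx γ → ℚ) : milnorForm γ x y = bilin γ x y := by
  simp only [milnorForm, bilin, Matrix.toBilin'_apply, Matrix.of_apply]
  exact sum_congr rfl fun p _ => sum_congr rfl fun q _ => by ring

lemma rho_eq_rhoLin (g : ∀ i, ZMod (γ i)) : rho γ g = rhoLin γ g := by
  ext1 x
  simp [rho, rhoLin, Fintype.linearCombination_apply]

lemma rhoLin_single (g : ∀ i, ZMod (γ i)) (p : MilnorIdx γ) :
    rhoLin γ g (Pi.single p 1) = rhoImg γ g p := by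
  simp [rhoLin]

lemma bilin_single (p q : MilnorIdx γ) :
    bilin γ (Pi.single p 1) (Pi.single q 1) = milnorGram γ p q := by
  simp [bilin, Matrix.toBilin'_single]

lemma milnorGram_comm (p q : MilnorIdx γ) : milnorGram γ p q = milnorGram γ q p := by
  rcases p with _ | _ | ⟨i, j⟩ <;> rcases q with _ | _ | ⟨i', j'⟩ <;>
    simp [milnorGram, eq_comm, or_comm]

lemma bilin_comm (x y : MilnorIdx γ → ℚ) : bilin γ x y = bilin γ y x := by
  rw [← milnorForm_eq_bilin, ← milnorForm_eq_bilin, milnorForm, milnorForm, sum_comm]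
  refine sum_congr rfl fun p _ => sum_congr rfl fun q _ => ?_
  rw [milnorGram_comm q p]
  ring

lemma bilin_delta0_left (x : MilnorIdx γ → ℚ) : bilin γ (mDelta0 γ) x = 0 := by
  rw [← milnorForm_eq_bilin, milnorForm]
  refine sum_eq_zero fun p _ => sum_eq_zero fun q _ => ?_
  rcases p with _ | p <;> simp [mDelta0, milnorGram]

lemma bilin_delta0_right (x : MilnorIdx γ → ℚ) : bilin γ x (mDelta0 γ) = 0 := by
  rw [bilin_comm, bilin_delta0_left]

lemma bilin_delta1_delta1 : bilin γ (mDelta1 γ) (mDelta1 γ) = -2 := by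
  simp [mDelta1, bilin_single, milnorGram]

lemma bilin_delta1_mid (i : Fin 3) (j : Fin (γ i - 1)) :
    bilin γ (mDelta1 γ) (mDeltaMid γ i j) = if j.val = 0 then 1 else 0 := by
  simp [mDelta1, mDeltaMid, bilin_single, milnorGram]

lemma bilin_mid_mid (i i' : Fin 3) (j : Fin (γ i - 1)) (j' : Fin (γ i' - 1)) :
    bilin γ (mDeltaMid γ i j) (mDeltaMid γ i' j') =
      if i = i' then
        (if j.val = j'.val then -2
         else if j.val + 1 = j'.val ∨ j'.val + 1 = j.val then 1 else 0)
      else 0 := by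
  simp [mDeltaMid, bilin_single, milnorGram]

lemma mDeltaNat_congr {i : Fin 3} {m n : ℕ} (h : m % γ i = n % γ i) :
    mDeltaNat γ i m = mDeltaNat γ i n := by
  simp only [mDeltaNat, h]

lemma mDeltaNat_zero {i : Fin 3} (hγ : 2 ≤ γ i) : mDeltaNat γ i 0 = mDeltaExt γ i := by
  simp [mDeltaNat, mDeltaCyc, show 0 < γ i by omega]

lemma mDeltaNat_succ {i : Fin 3} (j : Fin (γ i - 1)) :
    mDeltaNat γ i (j + 1) = mDeltaMid γ i j := by
  have hj := j.isLt
  have : (j.val + 1) % γ i = j + 1 := Nat.mod_eq_of_lt (by omega)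
  simp [mDeltaNat, mDeltaCyc, this, show 0 < γ i by omega]

lemma mDeltaNat_induction {i : Fin 3} (hγ : 2 ≤ γ i) {P : ℕ → Prop}
    (hmod : ∀ m n, m % γ i = n % γ i → P m → P n) (hzero : P 0)
    (hsucc : ∀ j : Fin (γ i - 1), P (j + 1)) (m : ℕ) : P m := by
  apply hmod (m % γ i) m (Nat.mod_mod _ _)
  have hm := Nat.mod_lt m (show 0 < γ i by omega)
  rcases Nat.eq_zero_or_pos (m % γ i) with h | h
  · rwa [h]
  · have := hsucc ⟨m % γ i - 1, by omega⟩
    rwa [Nat.sub_add_cancel h] at this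

lemma modInd_congr {c m m' n n' : ℕ} (hm : m % c = m' % c) (hn : n % c = n' % c) :
    modInd c m n = modInd c m' n' := by
  simp [modInd, hm, hn]

lemma modInd_add_right (c m n a : ℕ) : modInd c (m + a) (n + a) = modInd c m n := by
  unfold modInd
  congr 1
  exact propext ⟨fun h => Nat.ModEq.add_right_cancel' (n := c) a h,
    fun h => Nat.ModEq.add_right (n := c) a h⟩

lemma modInd_self (c m : ℕ) : modInd c m m = 1 := by simp [modInd]

lemma modInd_comm (c m n : ℕ) : modInd c m n = modInd c n m := by simp [modInd, eq_comm]

lemma modInd_of_le {c m n : ℕ} (hc : 2 ≤ c) (hm : m ≤ c) (hn : n ≤ c) :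
    modInd c m n = if m = n ∨ m = 0 ∧ n = c ∨ m = c ∧ n = 0 then 1 else 0 := by
  unfold modInd
  congr 1
  rcases hm.lt_or_eq with hm | rfl <;> rcases hn.lt_or_eq with hn | rfl <;>
    simp [Nat.mod_eq_of_lt, *] <;> omega

lemma sum_window {i : Fin 3} (hγ : 2 ≤ γ i) (a : ℕ) :
    ∑ j ∈ range (γ i), mDeltaNat γ i (j + a) = mDelta0 γ := by
  induction a with
  | zero =>
    obtain ⟨N, hN⟩ : ∃ N, γ i = N + 1 := ⟨γ i - 1, by omega⟩
    have : ∑ j ∈ range (γ i - 1), mDeltaNat γ i (j + 1) =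
        ∑ j : Fin (γ i - 1), mDeltaMid γ i j := by
      rw [← Fin.sum_univ_eq_sum_range (fun j => mDeltaNat γ i (j + 1))]
      exact sum_congr rfl fun j _ => mDeltaNat_succ j
    rw [show range (γ i) = range (γ i - 1 + 1) by congr 1; omega, sum_range_succ']
    simp only [add_zero]
    rw [this, mDeltaNat_zero hγ, mDeltaExt]
    abel
  | succ a ih =>
    have h := sum_range_succ (fun j => mDeltaNat γ i (j + a)) (γ i)
    rw [sum_range_succ', ih] at h
    have hp : mDeltaNat γ i (γ i + a) = mDeltaNat γ i (0 + a) :=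
      mDeltaNat_congr (by simp)
    rw [hp, add_left_inj] at h
    rw [← h]
    exact sum_congr rfl fun j _ => by congr 1; ring

lemma rhoLin_delta0 (g : ∀ i, ZMod (γ i)) : rhoLin γ g (mDelta0 γ) = mDelta0 γ := by
  rw [mDelta0, rhoLin_single]
  rfl

lemma rhoLin_mDeltaNat {i : Fin 3} (hγ : 2 ≤ γ i) (g : ∀ i, ZMod (γ i)) (m : ℕ) :
    rhoLin γ g (mDeltaNat γ i m) = mDeltaNat γ i (m + (g i).val) := by
  have hmid (j : Fin (γ i - 1)) :
      rhoLin γ g (mDeltaMid γ i j) = mDeltaNat γ i (j + 1 + (g i).val) := by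
    rw [mDeltaMid, rhoLin_single]
    rfl
  induction m using mDeltaNat_induction hγ with
  | hmod m n h ih =>
    rw [← mDeltaNat_congr h, ih]
    exact mDeltaNat_congr (Nat.ModEq.add_right (n := γ i) _ h)
  | hzero =>
    have hw := sum_window hγ (g i).val
    rw [show range (γ i) = range (γ i - 1 + 1) by congr 1; omega, sum_range_succ',
      ← Fin.sum_univ_eq_sum_range (fun j => mDeltaNat γ i (j + 1 + (g i).val))] at hw
    rw [mDeltaNat_zero hγ, mDeltaExt, map_sub, map_sum, rhoLin_delta0]
    simp only [hmid]
    rw [← hw]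
    abel
  | hsucc j => rw [mDeltaNat_succ, hmid]

lemma bilin_delta1_mDeltaNat {i : Fin 3} (hγ : 2 ≤ γ i) (m : ℕ) :
    bilin γ (mDelta1 γ) (mDeltaNat γ i m) = modInd (γ i) 1 m - modInd (γ i) 0 m := by
  induction m using mDeltaNat_induction hγ with
  | hmod m n h ih => rw [← mDeltaNat_congr h, ih, modInd_congr rfl h, modInd_congr rfl h]
  | hzero =>
    rw [mDeltaNat_zero hγ, mDeltaExt, map_sub, map_sum, bilin_delta0_right]
    simp only [bilin_delta1_mid]
    rw [Fin.sum_univ_eq_sum_range (fun j => if j = 0 then (1 : ℚ) else 0), modInd_self,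
      modInd_of_le hγ (by omega) (by omega)]
    simp
    split_ifs <;> grind
  | hsucc j =>
    have := j.isLt
    rw [mDeltaNat_succ, bilin_delta1_mid, modInd_of_le hγ (by omega) (by omega),
      modInd_of_le hγ (by omega) (by omega)]
    split_ifs <;> grind

lemma bilin_mDeltaNat_of_ne (hγ : ∀ i, 2 ≤ γ i) {i i' : Fin 3} (h : i ≠ i') (m n : ℕ) :
    bilin γ (mDeltaNat γ i m) (mDeltaNat γ i' n) = 0 := by
  induction m using mDeltaNat_induction (hγ i) with
  | hmod m m' h ih => rwa [← mDeltaNat_congr h]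
  | hzero =>
    induction n using mDeltaNat_induction (hγ i') with
    | hmod m m' h ih => rwa [← mDeltaNat_congr h]
    | hzero =>
      simp [mDeltaNat_zero, hγ, mDeltaExt, bilin_delta0_left, bilin_delta0_right,
        bilin_mid_mid, h]
    | hsucc k =>
      simp [mDeltaNat_zero, mDeltaNat_succ, hγ, mDeltaExt, bilin_delta0_left, bilin_mid_mid, h]
  | hsucc j =>
    induction n using mDeltaNat_induction (hγ i') with
    | hmod m m' h ih => rwa [← mDeltaNat_congr h]
    | hzero =>
      simp [mDeltaNat_zero, mDeltaNat_succ, hγ, mDeltaExt, bilin_delta0_right, bilin_mid_mid, h]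
    | hsucc k => simp [mDeltaNat_succ, bilin_mid_mid, h]

lemma bilin_mid_ext {i : Fin 3} (j : Fin (γ i - 1)) :
    bilin γ (mDeltaMid γ i j) (mDeltaExt γ i) =
      (if j.val = 0 then 1 else 0) + if j.val = γ i - 1 - 1 then 1 else 0 := by
  have hj := j.isLt
  let D : ℕ → ℚ := fun k => (if k = j.val then 1 else 0) - if k = j.val + 1 then 1 else 0
  have hD (k : Fin (γ i - 1)) :
      bilin γ (mDeltaMid γ i j) (mDeltaMid γ i k) = D (k + 1) - D k := by
    rw [bilin_mid_mid]
    simp only [D]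
    split_ifs <;> grind
  rw [mDeltaExt, map_sub, map_sum, bilin_delta0_right, sum_congr rfl fun k _ => hD k,
    Fin.sum_univ_eq_sum_range (fun k => D (k + 1) - D k), sum_range_sub]
  simp only [D]
  split_ifs <;> grind

lemma bilin_ext_ext {i : Fin 3} (hγ : 2 ≤ γ i) :
    bilin γ (mDeltaExt γ i) (mDeltaExt γ i) = -2 := by
  conv_lhs => arg 1; rw [mDeltaExt]
  rw [map_sub, map_sum, LinearMap.sub_apply, LinearMap.sum_apply, bilin_delta0_left]
  simp only [bilin_mid_ext]
  rw [Fin.sum_univ_eq_sum_range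
    (fun j => (if j = 0 then (1 : ℚ) else 0) + if j = γ i - 1 - 1 then 1 else 0),
    sum_add_distrib, sum_ite_eq', sum_ite_eq', if_pos (by simp; omega), if_pos (by simp; omega)]
  norm_num

lemma bilin_mDeltaNat {i : Fin 3} (hγ : 2 ≤ γ i) (m n : ℕ) :
    bilin γ (mDeltaNat γ i m) (mDeltaNat γ i n) =
      modInd (γ i) (m + 1) n + modInd (γ i) m (n + 1) - 2 * modInd (γ i) m n := by
  have hm' {m m' : ℕ} (h : m % γ i = m' % γ i) : (m + 1) % γ i = (m' + 1) % γ i :=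
    Nat.ModEq.add_right (n := γ i) 1 h
  induction m using mDeltaNat_induction hγ with
  | hmod m m' h ih =>
    rw [← mDeltaNat_congr h, ih, modInd_congr h rfl, modInd_congr h rfl, modInd_congr (hm' h) rfl]
  | hzero =>
    induction n using mDeltaNat_induction hγ with
    | hmod m m' h ih =>
      rw [← mDeltaNat_congr h, ih, modInd_congr rfl h, modInd_congr rfl h, modInd_congr rfl (hm' h)]
    | hzero =>
      rw [mDeltaNat_zero hγ, bilin_ext_ext hγ]
      rw [modInd_of_le hγ (by omega) (by omega), modInd_of_le hγ (by omega) (by omega),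
        modInd_of_le hγ (by omega) (by omega)]
      split_ifs <;> grind
    | hsucc k =>
      have := k.isLt
      rw [mDeltaNat_zero hγ, mDeltaNat_succ, bilin_comm, bilin_mid_ext]
      rw [modInd_of_le hγ (by omega) (by omega), modInd_of_le hγ (by omega) (by omega),
        modInd_of_le hγ (by omega) (by omega)]
      split_ifs <;> grind
  | hsucc j =>
    have := j.isLt
    induction n using mDeltaNat_induction hγ with
    | hmod m m' h ih =>
      rw [← mDeltaNat_congr h, ih, modInd_congr rfl h, modInd_congr rfl h, modInd_congr rfl (hm' h)]
    | hzero =>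
      rw [mDeltaNat_zero hγ, mDeltaNat_succ, bilin_mid_ext]
      rw [modInd_of_le hγ (by omega) (by omega), modInd_of_le hγ (by omega) (by omega),
        modInd_of_le hγ (by omega) (by omega)]
      split_ifs <;> grind
    | hsucc k =>
      have := k.isLt
      rw [mDeltaNat_succ, mDeltaNat_succ, bilin_mid_mid]
      rw [modInd_of_le hγ (by omega) (by omega), modInd_of_le hγ (by omega) (by omega),
        modInd_of_le hγ (by omega) (by omega)]
      split_ifs <;> grind

/-- `δ₁ + Σ_i Σ_{j=1}^{a_i} δ^i_j`. -/
noncomputable def shiftedDelta1 (γ : Fin 3 → ℕ) (a : Fin 3 → ℕ) : MilnorIdx γ → ℚ :=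
  mDelta1 γ + ∑ i : Fin 3, ∑ j ∈ range (a i), mDeltaNat γ i (j + 1)

lemma bilin_shiftedDelta1_mDeltaNat (hγ : ∀ i, 2 ≤ γ i) (a : Fin 3 → ℕ) (i : Fin 3) (m : ℕ) :
    bilin γ (shiftedDelta1 γ a) (mDeltaNat γ i m) =
      modInd (γ i) (a i + 1) m - modInd (γ i) (a i) m := by
  have key (n : ℕ) : bilin γ (mDelta1 γ) (mDeltaNat γ i m) +
      ∑ j ∈ range n, bilin γ (mDeltaNat γ i (j + 1)) (mDeltaNat γ i m) =
      modInd (γ i) (n + 1) m - modInd (γ i) n m := by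
    induction n with
    | zero => simp [bilin_delta1_mDeltaNat (hγ i)]
    | succ n ih =>
      rw [sum_range_succ, ← add_assoc, ih, bilin_mDeltaNat (hγ i), modInd_add_right]
      ring
  rw [shiftedDelta1, map_add, map_sum, LinearMap.add_apply, LinearMap.sum_apply, ← key,
    sum_eq_single i]
  · simp
  · intro i' _ hi'
    simp [bilin_mDeltaNat_of_ne hγ hi']
  · simp

lemma bilin_shiftedDelta1_self (hγ : ∀ i, 2 ≤ γ i) (a : Fin 3 → ℕ) :
    bilin γ (shiftedDelta1 γ a) (shiftedDelta1 γ a) = -2 := by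
  have h1 (i : Fin 3) : ∑ j ∈ range (a i), bilin γ (mDelta1 γ) (mDeltaNat γ i (j + 1)) =
      1 - modInd (γ i) 0 (a i) := by
    rw [← modInd_self (γ i) 0, ← sum_range_sub']
    refine sum_congr rfl fun j _ => ?_
    rw [bilin_delta1_mDeltaNat (hγ i), ← modInd_add_right (γ i) 0 j 1]
  have h2 (i : Fin 3) :
      ∑ j ∈ range (a i), bilin γ (shiftedDelta1 γ a) (mDeltaNat γ i (j + 1)) =
      modInd (γ i) 0 (a i) - 1 := by
    rw [← modInd_self (γ i) (a i), modInd_comm (γ i) 0, ← sum_range_sub']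
    refine sum_congr rfl fun j _ => ?_
    rw [bilin_shiftedDelta1_mDeltaNat hγ, modInd_add_right]
  have h3 : bilin γ (shiftedDelta1 γ a) (mDelta1 γ) = -2 + ∑ i, (1 - modInd (γ i) 0 (a i)) := by
    rw [bilin_comm, shiftedDelta1, map_add, map_sum, bilin_delta1_delta1]
    simp only [map_sum, h1]
  conv_lhs => arg 2; rw [shiftedDelta1]
  rw [map_add, map_sum, h3]
  simp only [map_sum, h2]
  rw [add_assoc, ← sum_add_distrib]
  simp

lemma rhoImg_delta1 (g : ∀ i, ZMod (γ i)) (u : Unit) :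
    rhoImg γ g (Sum.inr (Sum.inl u)) =
      shiftedDelta1 γ (fun i => (g i).val) - ageQ γ g • mDelta0 γ := rfl

lemma rhoImg_mid (g : ∀ i, ZMod (γ i)) (i : Fin 3) (j : Fin (γ i - 1)) :
    rhoImg γ g (Sum.inr (Sum.inr ⟨i, j⟩)) = mDeltaNat γ i (j + 1 + (g i).val) := rfl

lemma bilin_rhoImg (hγ : ∀ i, 2 ≤ γ i) (g : ∀ i, ZMod (γ i)) (p q : MilnorIdx γ) :
    bilin γ (rhoImg γ g p) (rhoImg γ g q) = milnorGram γ p q := by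
  have h1 (u : Unit) (i : Fin 3) (j : Fin (γ i - 1)) :
      bilin γ (rhoImg γ g (Sum.inr (Sum.inl u))) (rhoImg γ g (Sum.inr (Sum.inr ⟨i, j⟩))) =
        milnorGram γ (Sum.inr (Sum.inl u)) (Sum.inr (Sum.inr ⟨i, j⟩)) := by
    rw [rhoImg_delta1, rhoImg_mid, map_sub, map_smul, LinearMap.sub_apply, LinearMap.smul_apply,
      bilin_delta0_left, bilin_shiftedDelta1_mDeltaNat hγ, add_comm (g i).val 1, modInd_add_right]
    have h0 := modInd_add_right (γ i) 0 (j + 1) (g i).val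
    rw [zero_add] at h0
    rw [h0, ← bilin_delta1_mDeltaNat (hγ i), mDeltaNat_succ, bilin_delta1_mid]
    simp [milnorGram]
  rcases p with _ | _ | ⟨i, j⟩
  · exact bilin_delta0_left _
  · rcases q with _ | _ | ⟨i', j'⟩
    · exact bilin_delta0_right _
    · simp [rhoImg_delta1, bilin_delta0_left, bilin_delta0_right, bilin_shiftedDelta1_self hγ,
        milnorGram]
    · exact h1 _ _ _
  · rcases q with _ | _ | ⟨i', j'⟩
    · exact bilin_delta0_right _
    · rw [bilin_comm, milnorGram_comm]
      exact h1 _ _ _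
    · rw [← bilin_single, rhoImg_mid, rhoImg_mid]
      change _ = bilin γ (mDeltaMid γ i j) (mDeltaMid γ i' j')
      rw [← mDeltaNat_succ, ← mDeltaNat_succ]
      by_cases h : i = i'
      · subst h
        simp only [bilin_mDeltaNat (hγ i), add_right_comm _ (g i).val 1, modInd_add_right]
      · rw [bilin_mDeltaNat_of_ne hγ h, bilin_mDeltaNat_of_ne hγ h]

lemma bilin_rhoLin (hγ : ∀ i, 2 ≤ γ i) (g : ∀ i, ZMod (γ i)) (x y : MilnorIdx γ → ℚ) :
    bilin γ (rhoLin γ g x) (rhoLin γ g y) = bilin γ x y := by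
  have : (bilin γ).compl₁₂ (rhoLin γ g) (rhoLin γ g) = bilin γ := by
    refine LinearMap.BilinForm.ext_basis (Pi.basisFun ℚ (MilnorIdx γ)) fun p q => ?_
    simp only [Pi.basisFun_apply, LinearMap.compl₁₂_apply, rhoLin_single, bilin_single]
    exact bilin_rhoImg hγ g p q
  exact LinearMap.congr_fun₂ this x y

lemma sum_sub_smul_mod {i : Fin 3} (hγ : 2 ≤ γ i) (n : ℕ) :
    ∑ j ∈ range (n % γ i), mDeltaNat γ i (j + 1) - ((n % γ i : ℕ) / γ i : ℚ) • mDelta0 γ =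
      ∑ j ∈ range n, mDeltaNat γ i (j + 1) - (n / γ i : ℚ) • mDelta0 γ := by
  have hper : Function.Periodic
      (fun n : ℕ => ∑ j ∈ range n, mDeltaNat γ i (j + 1) - (n / γ i : ℚ) • mDelta0 γ) (γ i) := by
    intro n
    have hw : ∑ j ∈ range (γ i), mDeltaNat γ i (n + j + 1) = mDelta0 γ := by
      rw [← sum_window hγ (n + 1)]
      exact sum_congr rfl fun j _ => by congr 1; ring
    have hc : (γ i : ℚ) ≠ 0 := by positivity
    simp only
    rw [sum_range_add, hw, Nat.cast_add, add_div, div_self hc]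
    module
  exact hper.map_mod_nat n

lemma rhoImg_delta1_eq_sum (g : ∀ i, ZMod (γ i)) (u : Unit) :
    rhoImg γ g (Sum.inr (Sum.inl u)) = mDelta1 γ + ∑ i : Fin 3,
      (∑ j ∈ range (g i).val, mDeltaNat γ i (j + 1) - ((g i).val / γ i : ℚ) • mDelta0 γ) := by
  rw [rhoImg_delta1, shiftedDelta1, ageQ, sum_sub_distrib, sum_smul, add_sub_assoc]

lemma rhoLin_comp (hγ : ∀ i, 2 ≤ γ i) (g h : ∀ i, ZMod (γ i)) :
    rhoLin γ g ∘ₗ rhoLin γ h = rhoLin γ (g + h) := by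
  have hval (i : Fin 3) : ((g + h) i).val = ((g i).val + (h i).val) % γ i := by
    have : NeZero (γ i) := ⟨by have := hγ i; omega⟩
    rw [Pi.add_apply, ZMod.val_add]
  refine (Pi.basisFun ℚ (MilnorIdx γ)).ext fun p => ?_
  simp only [Pi.basisFun_apply, LinearMap.comp_apply, rhoLin_single]
  rcases p with _ | u | ⟨i, j⟩
  · exact rhoLin_delta0 g
  · have hδ : rhoLin γ g (mDelta1 γ) = rhoImg γ g (Sum.inr (Sum.inl u)) := rhoLin_single g _
    rw [rhoImg_delta1_eq_sum h, rhoImg_delta1_eq_sum (g + h), map_add, map_sum, hδ,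
      rhoImg_delta1_eq_sum g, add_assoc, ← sum_add_distrib]
    congr 1
    refine sum_congr rfl fun i _ => ?_
    rw [hval, sum_sub_smul_mod (hγ i), map_sub, map_sum, map_smul, rhoLin_delta0, sum_range_add,
      Nat.cast_add, add_div]
    simp only [rhoLin_mDeltaNat (hγ i)]
    have : ∑ j ∈ range (h i).val, mDeltaNat γ i (j + 1 + (g i).val) =
        ∑ j ∈ range (h i).val, mDeltaNat γ i ((g i).val + j + 1) :=
      sum_congr rfl fun j _ => by congr 1; ring
    rw [this]
    module
  · rw [rhoImg_mid, rhoImg_mid, rhoLin_mDeltaNat (hγ i), hval]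
    apply mDeltaNat_congr
    rw [Nat.add_mod_mod]
    congr 1
    ring

lemma rhoLin_zero : rhoLin γ 0 = LinearMap.id := by
  refine (Pi.basisFun ℚ (MilnorIdx γ)).ext fun p => ?_
  simp only [Pi.basisFun_apply, LinearMap.id_apply, rhoLin_single]
  have hval (i : Fin 3) : ((0 : ∀ i, ZMod (γ i)) i).val = 0 := by
    rw [Pi.zero_apply, ZMod.val_zero]
  rcases p with _ | u | ⟨i, j⟩
  · rfl
  · rw [rhoImg_delta1_eq_sum]
    simp [mDelta1]
  · rw [rhoImg_mid, hval, add_zero, mDeltaNat_succ]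
    rfl

end MilnorLattice

/-- For every `g, h ∈ G`:  (i) `ρ(g)` preserves the bilinear form
`⟨-,-⟩_V`; and (ii) `ρ(g) ∘ ρ(h) = ρ(g + h)` and `ρ(0) = id`, so that `ρ` defines an
action of `G` on `L(γ')` by isometries. -/
theorem rho_isometric_group_action
    (γ : Fin 3 → ℕ) (hγ : ∀ i, 2 ≤ γ i)
    (G : AddSubgroup (∀ i, ZMod (γ i)))
    (hSL : ∀ g ∈ G, ∃ m : ℤ, ageQ γ g = (m : ℚ)) :
    (∀ g ∈ G, ∀ x y : MilnorIdx γ → ℚ,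
      milnorForm γ (rho γ g x) (rho γ g y) = milnorForm γ x y) ∧
    (∀ g ∈ G, ∀ h ∈ G, rho γ g ∘ rho γ h = rho γ (g + h)) ∧
    rho γ 0 = id := by
  refine ⟨fun g _ x y => ?_, fun g _ h _ => ?_, ?_⟩
  · rw [MilnorLattice.rho_eq_rhoLin, MilnorLattice.milnorForm_eq_bilin,
      MilnorLattice.milnorForm_eq_bilin, MilnorLattice.bilin_rhoLin hγ]
  · simp only [MilnorLattice.rho_eq_rhoLin, ← MilnorLattice.rhoLin_comp hγ g h,
      LinearMap.coe_comp]
  · rw [MilnorLattice.rho_eq_rhoLin, MilnorLattice.rhoLin_zero, LinearMap.id_coe]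
end

section
/- Assume additionally that each γ_i ≥ 2 whenever it is referred to below. The averaged pairing satisfies: ⟨δ_1, δ_1⟩_W = 2j_G − 2; ⟨δ^i_j, δ^i_j⟩_W = −2n_i for i = 1,2,3 and 1 ≤ j ≤ γ_i − 1; ⟨δ_1, δ^i_1⟩_W = n_i for i = 1,2,3 with γ_i ≥ 2; ⟨δ^i_j, δ^i_{j+1}⟩_W = n_i for i = 1,2,3 and 1 ≤ j ≤ γ_i − 2; and ⟨−,−⟩_W vanishes on every other pair among the elements δ_1 and δ^i_j (i = 1,2,3, 1 ≤ j ≤ γ_i − 1). -/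
/-- The averaged pairing `⟨x, y⟩_W := Σ_{g ∈ G} ⟨x, ρ(g)(y)⟩_V`. -/
def formW (γ : Fin 3 → ℕ) (G : AddSubgroup (∀ i, ZMod (γ i))) [Fintype G]
    (x y : MilnorIdx γ → ℚ) : ℚ :=
  ∑ g : G, milnorForm γ x (rho γ (g : ∀ i, ZMod (γ i)) y)

section MilnorPairing

variable (γ : Fin 3 → ℕ)

theorem milnorForm_single_left (p : MilnorIdx γ) (y : MilnorIdx γ → ℚ) :
    milnorForm γ (Pi.single p 1) y = milnorGram γ p ⬝ᵥ y := by
  unfold milnorForm dotProduct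
  rw [Finset.sum_eq_single p (fun q _ hq => by simp [Pi.single_eq_of_ne hq]) (by simp)]
  exact Finset.sum_congr rfl fun q _ => by simp [mul_comm]

theorem rho_single (g : ∀ i, ZMod (γ i)) (p : MilnorIdx γ) :
    rho γ g (Pi.single p 1) = rhoImg γ g p := by
  unfold rho
  rw [Finset.sum_eq_single p (fun q _ hq => by simp [Pi.single_eq_of_ne hq]) (by simp)]
  simp

theorem formW_single (G : AddSubgroup (∀ i, ZMod (γ i))) [Fintype G] (p q : MilnorIdx γ) :
    formW γ G (Pi.single p 1) (Pi.single q 1) =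
      ∑ g : G, milnorGram γ p ⬝ᵥ rhoImg γ (g : ∀ i, ZMod (γ i)) q := by
  simp only [formW, milnorForm_single_left, rho_single]

theorem milnorGram_dotProduct_mDelta0 (p : MilnorIdx γ) :
    milnorGram γ p ⬝ᵥ mDelta0 γ = 0 := by
  rcases p with _ | _ | _ <;> simp [mDelta0, milnorGram]

theorem milnorGram_dotProduct_mDeltaExt (p : MilnorIdx γ) (i : Fin 3) :
    milnorGram γ p ⬝ᵥ mDeltaExt γ i =
      -∑ j : Fin (γ i - 1), milnorGram γ p (Sum.inr (Sum.inr ⟨i, j⟩)) := by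
  simp [mDeltaExt, dotProduct_sub, dotProduct_sum, milnorGram_dotProduct_mDelta0, mDeltaMid]

variable {γ}

theorem mDeltaNat_mod_eq_zero {i : Fin 3} (hi : 0 < γ i) {m : ℕ} (h : m % γ i = 0) :
    mDeltaNat γ i m = mDeltaExt γ i := by
  simp [mDeltaNat, mDeltaCyc, hi, h]

theorem mDeltaNat_mod_ne_zero {i : Fin 3} (hi : 0 < γ i) {m : ℕ} (h : m % γ i ≠ 0) :
    mDeltaNat γ i m =
      mDeltaMid γ i ⟨m % γ i - 1, by have := Nat.mod_lt m hi; omega⟩ := by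
  simp [mDeltaNat, mDeltaCyc, hi, h]

theorem milnorGram_delta1_dotProduct_mDeltaNat {i : Fin 3} (hi : 2 ≤ γ i) (m : ℕ) :
    milnorGram γ (Sum.inr (Sum.inl ())) ⬝ᵥ mDeltaNat γ i m =
      (if (m : ZMod (γ i)) = (1 : ℕ) then 1 else 0) -
        (if (m : ZMod (γ i)) = (0 : ℕ) then 1 else 0) := by
  have hm := Nat.mod_lt m (show 0 < γ i by omega)
  simp only [ZMod.natCast_eq_natCast_iff', Nat.zero_mod, Nat.mod_eq_of_lt (show 1 < γ i by omega)]
  by_cases h : m % γ i = 0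
  · rw [mDeltaNat_mod_eq_zero (by omega) h, milnorGram_dotProduct_mDeltaExt]
    simp only [milnorGram]
    rw [Fin.sum_univ_eq_sum_range (fun k => if k = 0 then (1 : ℚ) else 0)]
    have : 0 < γ i - 1 := by omega
    simp [h, this]
  · rw [mDeltaNat_mod_ne_zero (by omega) h]
    simp only [mDeltaMid, dotProduct_single, milnorGram, h]
    have : m % γ i - 1 = 0 ↔ m % γ i = 1 := by omega
    simp [this]

theorem milnorGram_mid_dotProduct_mDeltaNat_self {i : Fin 3} (hi : 2 ≤ γ i)
    (j : Fin (γ i - 1)) (m : ℕ) :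
    milnorGram γ (Sum.inr (Sum.inr ⟨i, j⟩)) ⬝ᵥ mDeltaNat γ i m =
      -2 * (if (m : ZMod (γ i)) = (j.val + 1 : ℕ) then 1 else 0) +
        (if (m : ZMod (γ i)) = (j.val + 2 : ℕ) then 1 else 0) +
        (if (m : ZMod (γ i)) = (j.val : ℕ) then 1 else 0) := by
  have hm := Nat.mod_lt m (show 0 < γ i by omega)
  have hj := j.isLt
  have hgram (k : ℕ) :
      (if j.val = k then (-2 : ℚ) else if j.val + 1 = k ∨ k + 1 = j.val then 1 else 0) =
        -2 * (if k = j.val then 1 else 0) + (if k = j.val + 1 then 1 else 0) +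
          (if k = j.val - 1 then if 1 ≤ j.val then 1 else 0 else 0) := by
    split_ifs <;> first | omega | norm_num
  have hmod : (j.val + 2) % γ i = if j.val + 2 = γ i then 0 else j.val + 2 := by
    split_ifs with h
    · simp [h]
    · exact Nat.mod_eq_of_lt (by omega)
  simp only [ZMod.natCast_eq_natCast_iff', hmod, Nat.mod_eq_of_lt (show j.val + 1 < γ i by omega),
    Nat.mod_eq_of_lt (show j.val < γ i by omega)]
  by_cases h : m % γ i = 0
  · rw [mDeltaNat_mod_eq_zero (by omega) h, milnorGram_dotProduct_mDeltaExt]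
    simp only [milnorGram, if_true, hgram]
    rw [Fin.sum_univ_eq_sum_range (fun k => -2 * (if k = j.val then (1 : ℚ) else 0) +
      (if k = j.val + 1 then 1 else 0) +
        (if k = j.val - 1 then if 1 ≤ j.val then 1 else 0 else 0))]
    simp only [Finset.sum_add_distrib, ← Finset.mul_sum, Finset.sum_ite_eq', Finset.mem_range, h]
    split_ifs <;> first | contradiction | omega | norm_num
  · rw [mDeltaNat_mod_ne_zero (by omega) h]
    simp only [mDeltaMid, dotProduct_single, milnorGram, if_true, hgram]
    split_ifs <;> first | omega | norm_num

theorem milnorGram_mid_dotProduct_mDeltaNat_of_ne {i i' : Fin 3} (hi : 0 < γ i') (hne : i ≠ i')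
    (j : Fin (γ i - 1)) (m : ℕ) :
    milnorGram γ (Sum.inr (Sum.inr ⟨i, j⟩)) ⬝ᵥ mDeltaNat γ i' m = 0 := by
  by_cases h : m % γ i' = 0
  · rw [mDeltaNat_mod_eq_zero hi h, milnorGram_dotProduct_mDeltaExt]
    simp [milnorGram, hne]
  · rw [mDeltaNat_mod_ne_zero hi h]
    simp [mDeltaMid, milnorGram, hne]

theorem milnorGram_delta1_dotProduct_rhoImg_delta1 (hγ : ∀ i, 2 ≤ γ i) (g : ∀ i, ZMod (γ i)) :
    milnorGram γ (Sum.inr (Sum.inl ())) ⬝ᵥ rhoImg γ g (Sum.inr (Sum.inl ())) =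
      -2 + ∑ i, if g i = 0 then (0 : ℚ) else 1 := by
  have hsum (i : Fin 3) : ∑ j ∈ Finset.range (g i).val,
      milnorGram γ (Sum.inr (Sum.inl ())) ⬝ᵥ mDeltaNat γ i (j + 1) =
        if g i = 0 then (0 : ℚ) else 1 := by
    have : NeZero (γ i) := ⟨by have := hγ i; omega⟩
    have hlt := ZMod.val_lt (g i)
    calc _ = ∑ j ∈ Finset.range (g i).val, if j = 0 then (1 : ℚ) else 0 := by
          refine Finset.sum_congr rfl fun j hj => ?_
          rw [Finset.mem_range] at hj
          rw [milnorGram_delta1_dotProduct_mDeltaNat (hγ i)]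
          simp only [ZMod.natCast_eq_natCast_iff', Nat.zero_mod,
            Nat.mod_eq_of_lt (show 1 < γ i by have := hγ i; omega),
            Nat.mod_eq_of_lt (show j + 1 < γ i by omega)]
          simp
      _ = _ := by
          simp only [Finset.sum_ite_eq', Finset.mem_range, ← ZMod.val_eq_zero]
          split_ifs <;> first | omega | rfl
  simp only [rhoImg, dotProduct_sub, dotProduct_add, dotProduct_sum, dotProduct_smul,
    milnorGram_dotProduct_mDelta0, hsum]
  simp [mDelta1, milnorGram]

theorem ageQ_neg_of_ne_zero (hγ : ∀ i, γ i ≠ 0) {g : ∀ i, ZMod (γ i)} (hg : ∀ i, g i ≠ 0) :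
    ageQ γ (-g) = 3 - ageQ γ g := by
  have h (i : Fin 3) : (((-g) i).val : ℚ) / γ i = 1 - ((g i).val : ℚ) / γ i := by
    have : NeZero (γ i) := ⟨hγ i⟩
    have hγ' : (γ i : ℚ) ≠ 0 := by exact_mod_cast hγ i
    rw [Pi.neg_apply, ZMod.neg_val, if_neg (hg i), Nat.cast_sub (ZMod.val_lt _).le]
    field_simp
  simp [ageQ, h, -Pi.neg_apply]

theorem sum_ne_zero_eq_of_ageQ (hγ : ∀ i, γ i ≠ 0) {g : ∀ i, ZMod (γ i)}
    (hg : ∃ m : ℤ, ageQ γ g = m) :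
    (-2 + ∑ i, if g i = 0 then (0 : ℚ) else 1) =
      (if ageQ γ g = 1 ∧ ∀ i, g i ≠ 0 then 1 else 0) +
        (if ageQ γ (-g) = 1 ∧ ∀ i, (-g) i ≠ 0 then 1 else 0) -
          2 * (if g = 0 then 1 else 0) := by
  obtain ⟨m, hm⟩ := hg
  have h0 (i : Fin 3) (h : g i ≠ 0) : 0 < ((g i).val : ℚ) / γ i := by
    have := (ZMod.val_ne_zero _).2 h
    have := hγ i
    positivity
  have h1 (i : Fin 3) : ((g i).val : ℚ) / γ i < 1 := by
    have : NeZero (γ i) := ⟨hγ i⟩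
    have hγ' : (0 : ℚ) < γ i := by have := hγ i; positivity
    rw [div_lt_one hγ']
    exact_mod_cast ZMod.val_lt _
  by_cases hall : ∀ i, g i ≠ 0
  · have hne : g ≠ 0 := fun h => hall 0 (by simp [h])
    have hage : ageQ γ g = 1 ∨ ageQ γ g = 2 := by
      have hpos : 0 < ageQ γ g := Finset.sum_pos (fun i _ => h0 i (hall i)) ⟨0, by simp⟩
      have hlt : ageQ γ g < 3 := by
        have := h1 0; have := h1 1; have := h1 2
        rw [ageQ, Fin.sum_univ_three]
        linarith
      rw [hm] at hpos hlt ⊢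
      norm_cast at hpos hlt ⊢
      omega
    have hall' : ∀ i, (-g) i ≠ 0 := fun i => by simpa using hall i
    simp only [ageQ_neg_of_ne_zero hγ hall, and_iff_left hall, and_iff_left hall', hne, if_false]
    rcases hage with h | h <;> simp [h, hall] <;> norm_num
  · have hall' : ¬ ∀ i, (-g) i ≠ 0 := by simpa using hall
    rw [if_neg (fun h => hall h.2), if_neg (fun h => hall' h.2)]
    have hz : g = 0 ↔ g 0 = 0 ∧ g 1 = 0 ∧ g 2 = 0 := by
      rw [funext_iff, Fin.forall_fin_succ, Fin.forall_fin_two]; rfl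
    rw [Fin.forall_fin_succ, Fin.forall_fin_two] at hall
    change ¬ (g 0 ≠ 0 ∧ g 1 ≠ 0 ∧ g 2 ≠ 0) at hall
    have hone (i : Fin 3) (hi : g i ≠ 0) (h : ageQ γ g = ((g i).val : ℚ) / γ i) : False := by
      have hpos := h0 i hi
      have hlt := h1 i
      rw [← h, hm] at hpos hlt
      norm_cast at hpos hlt
      omega
    have hage : ageQ γ g = _ := Fin.sum_univ_three _
    simp only [hz, Fin.sum_univ_three]
    by_cases a0 : g 0 = 0 <;> by_cases a1 : g 1 = 0 <;> by_cases a2 : g 2 = 0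
    · simp [a0, a1, a2]
    · exact (hone 2 a2 (by rw [hage, a0, a1]; simp)).elim
    · exact (hone 1 a1 (by rw [hage, a0, a2]; simp)).elim
    · simp [a0, a1, a2]; norm_num
    · exact (hone 0 a0 (by rw [hage, a1, a2]; simp)).elim
    · simp [a0, a1, a2]; norm_num
    · simp [a0, a1, a2]; norm_num
    · exact (hall ⟨a0, a1, a2⟩).elim

end MilnorPairing

/-- A subgroup of `ZMod N` of order `d` consists of the multiples of `N / d`. -/
theorem ZMod.intCast_mem_addSubgroup_iff {N : ℕ} [NeZero N] (H : AddSubgroup (ZMod N)) (c : ℤ) :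
    (c : ZMod N) ∈ H ↔ ((N / Nat.card H : ℕ) : ℤ) ∣ c := by
  classical
  obtain ⟨e, he⟩ : Nat.card H ∣ N := by
    simpa using H.card_addSubgroup_dvd_card
  have hd : 0 < Nat.card H := Nat.card_pos
  have hmem (x : ZMod N) : x ∈ H ↔ Nat.card H • x = 0 := by
    have hsub : (H : Set (ZMod N)).toFinset ⊆
        Finset.univ.filter fun x : ZMod N => Nat.card H • x = 0 := by
      intro x hx
      have hx' : x ∈ H := by simpa using hx
      simp only [Finset.mem_filter, Finset.mem_univ, true_and]
      exact congrArg Subtype.val (card_nsmul_eq_zero' (x := (⟨x, hx'⟩ : H)))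
    have heq := Finset.eq_of_subset_of_card_le hsub
      ((IsAddCyclic.card_nsmul_eq_zero_le hd).trans (by
        rw [Set.toFinset_card, Nat.card_eq_fintype_card]; exact le_of_eq (by congr)))
    simpa using congrArg (x ∈ ·) heq
  have hN : N / Nat.card H = e := by
    exact Nat.div_eq_of_eq_mul_right hd he
  have hcast : Nat.card H • (c : ZMod N) = ((Nat.card H * c : ℤ) : ZMod N) := by
    push_cast; simp
  rw [hmem, hN, hcast, ZMod.intCast_zmod_eq_zero_iff_dvd]
  have heZ : (N : ℤ) = Nat.card H * e := by exact_mod_cast he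
  simpa only [heZ] using mul_dvd_mul_iff_left (by exact_mod_cast hd.ne')

/-- Fibre count of a homomorphism from a finite group to `ZMod N`. -/
theorem AddMonoidHom.sum_ite_eq_intCast {N : ℕ} [NeZero N] {G : Type*} [AddCommGroup G] [Fintype G]
    (φ : G →+ ZMod N) (c : ℤ) :
    (∑ g : G, if φ g = c then (1 : ℚ) else 0) =
      if ((N / (Nat.card G / Nat.card {g : G // φ g = 0}) : ℕ) : ℤ) ∣ c then
        (Nat.card {g : G // φ g = 0} : ℚ) else 0 := by
  classical
  have hcard : Nat.card G / Nat.card {g : G // φ g = 0} = Nat.card φ.range := by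
    refine Nat.div_eq_of_eq_mul_left (Nat.card_pos (α := φ.ker)) ?_
    rw [AddSubgroup.card_eq_card_quotient_mul_card_addSubgroup φ.ker,
      Nat.card_congr (QuotientAddGroup.quotientKerEquivRange φ).toEquiv]
    rfl
  simp only [hcard, ← ZMod.intCast_mem_addSubgroup_iff]
  split_ifs with h
  · obtain ⟨g₀, hg₀⟩ := h
    rw [← Equiv.sum_comp (Equiv.addRight g₀)]
    simp [hg₀, Nat.card_eq_fintype_card, Fintype.card_subtype]
  · exact Finset.sum_eq_zero fun g _ => if_neg fun hg => h ⟨g, hg⟩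

/-- Number of `g ∈ G` with prescribed `i`-th coordinate. -/
theorem AddSubgroup.sum_ite_apply_eq {γ : Fin 3 → ℕ} (hγ : ∀ i, γ i ≠ 0)
    (G : AddSubgroup (∀ i, ZMod (γ i))) [Fintype G] (i : Fin 3) (a b : ℕ) :
    (∑ g : G, if ((a + ((g : ∀ i, ZMod (γ i)) i).val : ℕ) : ZMod (γ i)) = b then (1 : ℚ) else 0) =
      if ((γ i / (Nat.card G / Nat.card {g : G // (g : ∀ i', ZMod (γ i')) i = 0}) : ℕ) : ℤ) ∣
          (b : ℤ) - a then
        (Nat.card {g : G // (g : ∀ i', ZMod (γ i')) i = 0} : ℚ) else 0 := by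
  have : NeZero (γ i) := ⟨hγ i⟩
  have h := AddMonoidHom.sum_ite_eq_intCast
    ((Pi.evalAddMonoidHom (fun i => ZMod (γ i)) i).comp G.subtype) ((b : ℤ) - a)
  simp only [AddMonoidHom.comp_apply, AddSubgroup.subtype_apply, Pi.evalAddMonoidHom_apply] at h
  rw [← h]
  refine Finset.sum_congr rfl fun g _ => ?_
  congr 1
  push_cast
  rw [ZMod.natCast_zmod_val, eq_sub_iff_add_eq, add_comm]

/-- With `n i = |K i|`, `d i = |G/K i|`, `γ_i = γ'_i / d i` and `j_G` the
number of `g ∈ G` of age `1` with all `a_i(g) ≠ 0`, the averaged pairing satisfies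
`⟨δ₁, δ₁⟩_W = 2j_G - 2`, `⟨δ^i_j, δ^i_j⟩_W = -2n_i` for `1 ≤ j ≤ γ_i - 1`,
`⟨δ₁, δ^i_1⟩_W = n_i` (when `γ_i ≥ 2`), `⟨δ^i_j, δ^i_{j+1}⟩_W = n_i` for
`1 ≤ j ≤ γ_i - 2`, and `⟨-,-⟩_W` vanishes on every other pair among the elements `δ₁` and
`δ^i_j` (`i = 1,2,3`, `1 ≤ j ≤ γ_i - 1`). -/
theorem averaged_pairing_coxeter_dynkin
    (γ : Fin 3 → ℕ) (hγ : ∀ i, 2 ≤ γ i)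
    (G : AddSubgroup (∀ i, ZMod (γ i))) [Fintype G]
    (hSL : ∀ g ∈ G, ∃ m : ℤ, ageQ γ g = (m : ℚ))
    (n d γs : Fin 3 → ℕ) (jG : ℕ)
    (hn : ∀ i, n i = Nat.card {g : G // (g : ∀ i', ZMod (γ i')) i = 0})
    (hd : ∀ i, d i = Nat.card G / n i)
    (hγs : ∀ i, γs i = γ i / d i)
    (hjG : jG = Nat.card
      {g : G // ageQ γ (g : ∀ i', ZMod (γ i')) = 1 ∧ ∀ i, (g : ∀ i', ZMod (γ i')) i ≠ 0}) :
    formW γ G (mDelta1 γ) (mDelta1 γ) = 2 * (jG : ℚ) - 2 ∧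
    (∀ i, ∀ j : Fin (γ i - 1), j.val + 1 ≤ γs i - 1 →
      formW γ G (mDeltaMid γ i j) (mDeltaMid γ i j) = -2 * (n i : ℚ)) ∧
    (∀ i, 2 ≤ γs i →
      formW γ G (mDelta1 γ) (mDeltaMid γ i ⟨0, by have := hγ i; omega⟩) = (n i : ℚ)) ∧
    (∀ i, ∀ j j' : Fin (γ i - 1), j'.val = j.val + 1 → j.val + 1 ≤ γs i - 2 →
      formW γ G (mDeltaMid γ i j) (mDeltaMid γ i j') = (n i : ℚ)) ∧
    (∀ i, ∀ j : Fin (γ i - 1), 1 ≤ j.val → j.val + 1 ≤ γs i - 1 →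
      formW γ G (mDelta1 γ) (mDeltaMid γ i j) = 0) ∧
    (∀ i i', ∀ j : Fin (γ i - 1), ∀ j' : Fin (γ i' - 1),
      j.val + 1 ≤ γs i - 1 → j'.val + 1 ≤ γs i' - 1 →
      (i ≠ i' ∨ j.val + 2 ≤ j'.val ∨ j'.val + 2 ≤ j.val) →
      formW γ G (mDeltaMid γ i j) (mDeltaMid γ i' j') = 0) := by
  have hγ0 : ∀ i, γ i ≠ 0 := fun i => by have := hγ i; omega
  have hcount (i : Fin 3) (a b : ℕ) :
      (∑ g : G, if ((a + ((g : ∀ i, ZMod (γ i)) i).val : ℕ) : ZMod (γ i)) = b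
        then (1 : ℚ) else 0) = if (γs i : ℤ) ∣ (b : ℤ) - a then (n i : ℚ) else 0 := by
    rw [AddSubgroup.sum_ite_apply_eq hγ0, hγs, hd, hn]
  have hndvd {s : ℕ} {c : ℤ} (hc : c ≠ 0) (h₁ : -(s : ℤ) < c) (h₂ : c < s) : ¬ (s : ℤ) ∣ c :=
    fun h => hc (Int.eq_zero_of_abs_lt_dvd h (abs_lt.2 ⟨h₁, h₂⟩))
  have hone (i : Fin 3) (j : Fin (γ i - 1)) :
      formW γ G (mDelta1 γ) (mDeltaMid γ i j) =
        (if (γs i : ℤ) ∣ ((1 : ℕ) : ℤ) - (j.val + 1 : ℕ) then (n i : ℚ) else 0) -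
          (if (γs i : ℤ) ∣ ((0 : ℕ) : ℤ) - (j.val + 1 : ℕ) then (n i : ℚ) else 0) := by
    simp only [mDelta1, mDeltaMid, formW_single, rhoImg,
      milnorGram_delta1_dotProduct_mDeltaNat (hγ i), Finset.sum_sub_distrib, hcount]
  have hmid (i : Fin 3) (j j' : Fin (γ i - 1)) :
      formW γ G (mDeltaMid γ i j) (mDeltaMid γ i j') =
        -2 * (if (γs i : ℤ) ∣ ((j.val + 1 : ℕ) : ℤ) - (j'.val + 1 : ℕ) then (n i : ℚ) else 0) +
          (if (γs i : ℤ) ∣ ((j.val + 2 : ℕ) : ℤ) - (j'.val + 1 : ℕ) then (n i : ℚ) else 0) +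
          (if (γs i : ℤ) ∣ (j.val : ℤ) - (j'.val + 1 : ℕ) then (n i : ℚ) else 0) := by
    simp only [mDeltaMid, formW_single, rhoImg,
      milnorGram_mid_dotProduct_mDeltaNat_self (hγ i), Finset.sum_add_distrib,
      ← Finset.mul_sum, hcount]
  refine ⟨?_, fun i j hj => ?_, fun i hi => ?_, fun i j j' hjj' hj => ?_, fun i j hj1 hj => ?_,
    fun i i' j j' hj hj' hne => ?_⟩
  · have hsum : (∑ g : G, if ageQ γ (g : ∀ i, ZMod (γ i)) = 1 ∧
        ∀ i, (g : ∀ i, ZMod (γ i)) i ≠ 0 then (1 : ℚ) else 0) = jG := by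
      rw [hjG, Nat.card_eq_fintype_card, Fintype.card_subtype, Finset.sum_boole]
    have hsum' : (∑ g : G, if ageQ γ (-(g : ∀ i, ZMod (γ i))) = 1 ∧
        ∀ i, (-(g : ∀ i, ZMod (γ i))) i ≠ 0 then (1 : ℚ) else 0) = jG := by
      rw [← hsum]
      exact Equiv.sum_comp (Equiv.neg G) fun g : G =>
        if ageQ γ (g : ∀ i, ZMod (γ i)) = 1 ∧ ∀ i, (g : ∀ i, ZMod (γ i)) i ≠ 0
          then (1 : ℚ) else 0
    simp only [mDelta1, formW_single, milnorGram_delta1_dotProduct_rhoImg_delta1 hγ]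
    rw [Finset.sum_congr rfl fun (g : G) _ => sum_ne_zero_eq_of_ageQ hγ0 (hSL g g.2)]
    rw [Finset.sum_sub_distrib, Finset.sum_add_distrib, ← Finset.mul_sum, hsum, hsum']
    simp only [ZeroMemClass.coe_eq_zero, Finset.sum_ite_eq', Finset.mem_univ, if_true]
    ring
  · rw [hmid, if_pos (by simp), if_neg (hndvd (by omega) (by omega) (by omega)),
      if_neg (hndvd (by omega) (by omega) (by omega))]
    ring
  · rw [hone, if_pos (by simp), if_neg (hndvd (by simp) (by simp; omega) (by simp; omega))]
    ring
  · rw [hmid, if_neg (hndvd (by omega) (by omega) (by omega)), if_pos ⟨0, by rw [hjj']; push_cast; ring⟩,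
      if_neg (hndvd (by omega) (by omega) (by omega))]
    ring
  · rw [hone, if_neg (hndvd (by omega) (by omega) (by omega)),
      if_neg (hndvd (by omega) (by omega) (by omega))]
    ring
  · by_cases hii : i = i'
    · subst hii
      rw [hmid, if_neg (hndvd (by omega) (by omega) (by omega)),
        if_neg (hndvd (by omega) (by omega) (by omega)),
        if_neg (hndvd (by omega) (by omega) (by omega))]
      ring
    · simp only [mDeltaMid, formW_single, rhoImg,
        milnorGram_mid_dotProduct_mDeltaNat_of_ne (Nat.pos_of_ne_zero (hγ0 i')) hii,
        Finset.sum_const_zero]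
end

section
/- Under the stated hypotheses, the elements δ̂_1 and δ̂^i_{j,k} satisfy: ⟨δ̂_1, δ̂_1⟩_Z = c; ⟨δ̂^i_{j,k}, δ̂^i_{j,k}⟩_Z = −2 for all i = 1,2,3, 1 ≤ j ≤ γ_i − 1, 0 ≤ k ≤ n_i − 1; ⟨δ̂_1, δ̂^i_{1,k}⟩_Z = 1 and ⟨δ̂^i_{j,k}, δ̂^i_{j+1,k}⟩_Z = 1 for all i = 1,2,3, 1 ≤ j ≤ γ_i − 2, 0 ≤ k ≤ n_i − 1; and ⟨−,−⟩_Z vanishes on every other pair among the elements of {δ̂_1} ∪ {δ̂^i_{j,k}}. -/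
/-- Let `n_i, γ_i` be positive integers, `c ∈ ℚ`, and let `H_W, H_Z` be
`ℚ`-vector spaces with symmetric bilinear forms `B_W, B_Z` and a form-preserving linear map
`h : H_W → H_Z`.  Given elements `δ̄_1, δ̄^i_j ∈ H_W` with the pairings of
Fig. 4 (`⟨δ̄_1,δ̄_1⟩ = c`, `⟨δ̄^i_j,δ̄^i_j⟩ = -2n_i`, `⟨δ̄_1,δ̄^i_1⟩ = ⟨δ̄^i_j,δ̄^i_{j+1}⟩ = n_i`,
all other pairs `0`), and elements `λ^i_{j,k} ∈ H_Z` (for `n_i > 1`, `1 ≤ j ≤ γ_i`,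
`0 ≤ k ≤ n_i - 1`) with `⟨λ^i_{j,k},λ^i_{j,k}⟩ = -(n_i-1)/n_i`,
`⟨λ^i_{j,k},λ^i_{j,k'}⟩ = 1/n_i` for `k ≠ k'`, `⟨λ^i_{j,k},λ^{i'}_{j',k'}⟩ = 0` for
`(i,j) ≠ (i',j')`, and `⟨h(x),λ^i_{j,k}⟩ = 0` for all `x ∈ H_W`, the elements
`δ̂_1 := h(δ̄_1)` and `δ̂^i_{j,k} := h(δ̄^i_j)` (if `n_i = 1`), resp.
`δ̂^i_{j,k} := (1/n_i)·h(δ̄^i_j) + (λ^i_{j,k} - λ^i_{j+1,k})` (if `n_i > 1`), satisfy: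
`⟨δ̂_1,δ̂_1⟩ = c`; `⟨δ̂^i_{j,k},δ̂^i_{j,k}⟩ = -2`; `⟨δ̂_1,δ̂^i_{1,k}⟩ = 1` and
`⟨δ̂^i_{j,k},δ̂^i_{j+1,k}⟩ = 1`; and `⟨-,-⟩_Z` vanishes on every other pair among
`{δ̂_1} ∪ {δ̂^i_{j,k}}`. -/
theorem dhat_pairings
    {HW HZ : Type*} [AddCommGroup HW] [Module ℚ HW] [AddCommGroup HZ] [Module ℚ HZ]
    (n γ : Fin 3 → ℕ) (hn : ∀ i, 0 < n i) (hγ : ∀ i, 0 < γ i) (c : ℚ)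
    (BW : HW →ₗ[ℚ] HW →ₗ[ℚ] ℚ) (BZ : HZ →ₗ[ℚ] HZ →ₗ[ℚ] ℚ)
    (hBWsymm : ∀ x y, BW x y = BW y x) (hBZsymm : ∀ x y, BZ x y = BZ y x)
    (h : HW →ₗ[ℚ] HZ) (hiso : ∀ x y, BZ (h x) (h y) = BW x y)
    (d1 : HW) (dm : Fin 3 → ℕ → HW)
    (hd11 : BW d1 d1 = c)
    (hdmm : ∀ i, ∀ j, 1 ≤ j → j ≤ γ i - 1 → BW (dm i j) (dm i j) = -2 * (n i : ℚ))
    (hd1m1 : ∀ i, 1 ≤ γ i - 1 → BW d1 (dm i 1) = (n i : ℚ))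
    (hadj : ∀ i, ∀ j, 1 ≤ j → j + 1 ≤ γ i - 1 → BW (dm i j) (dm i (j + 1)) = (n i : ℚ))
    (hd1m0 : ∀ i, ∀ j, 2 ≤ j → j ≤ γ i - 1 → BW d1 (dm i j) = 0)
    (hoth : ∀ i i' j j', 1 ≤ j → j ≤ γ i - 1 → 1 ≤ j' → j' ≤ γ i' - 1 →
      (i ≠ i' ∨ j + 2 ≤ j' ∨ j' + 2 ≤ j) → BW (dm i j) (dm i' j') = 0)
    (lam : Fin 3 → ℕ → ℕ → HZ)
    (hlamself : ∀ i, 1 < n i → ∀ j, 1 ≤ j → j ≤ γ i → ∀ k, k ≤ n i - 1 →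
      BZ (lam i j k) (lam i j k) = -((n i : ℚ) - 1) / (n i : ℚ))
    (hlamkk' : ∀ i, 1 < n i → ∀ j, 1 ≤ j → j ≤ γ i → ∀ k k', k ≤ n i - 1 → k' ≤ n i - 1 →
      k ≠ k' → BZ (lam i j k) (lam i j k') = 1 / (n i : ℚ))
    (hlamorth : ∀ i i', 1 < n i → 1 < n i' → ∀ j j' k k', 1 ≤ j → j ≤ γ i → 1 ≤ j' →
      j' ≤ γ i' → k ≤ n i - 1 → k' ≤ n i' - 1 → (i, j) ≠ (i', j') →
      BZ (lam i j k) (lam i' j' k') = 0)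
    (hlamW : ∀ i, 1 < n i → ∀ j k, 1 ≤ j → j ≤ γ i → k ≤ n i - 1 → ∀ x : HW,
      BZ (h x) (lam i j k) = 0)
    (dhat1 : HZ) (hdhat1 : dhat1 = h d1)
    (dhat : Fin 3 → ℕ → ℕ → HZ)
    (hdhatdef : ∀ i j k, dhat i j k =
      if n i = 1 then h (dm i j)
      else (1 / (n i : ℚ)) • h (dm i j) + (lam i j k - lam i (j + 1) k)) :
    BZ dhat1 dhat1 = c ∧
    (∀ i j k, 1 ≤ j → j ≤ γ i - 1 → k ≤ n i - 1 →
      BZ (dhat i j k) (dhat i j k) = -2) ∧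
    (∀ i k, 1 ≤ γ i - 1 → k ≤ n i - 1 → BZ dhat1 (dhat i 1 k) = 1) ∧
    (∀ i j k, 1 ≤ j → j + 1 ≤ γ i - 1 → k ≤ n i - 1 →
      BZ (dhat i j k) (dhat i (j + 1) k) = 1) ∧
    (∀ i j k, 2 ≤ j → j ≤ γ i - 1 → k ≤ n i - 1 → BZ dhat1 (dhat i j k) = 0) ∧
    (∀ i i' j j' k k', 1 ≤ j → j ≤ γ i - 1 → 1 ≤ j' → j' ≤ γ i' - 1 →
      k ≤ n i - 1 → k' ≤ n i' - 1 →
      ¬(i = i' ∧ j = j' ∧ k = k') →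
      ¬(i = i' ∧ k = k' ∧ (j + 1 = j' ∨ j' + 1 = j)) →
      BZ (dhat i j k) (dhat i' j' k') = 0) := by
  have hn0 : ∀ i, (n i : ℚ) ≠ 0 := fun i => Nat.cast_ne_zero.mpr (hn i).ne'
  -- Setting the `λ`-terms to zero when `n i = 1` makes one formula valid for all `n i`.
  obtain ⟨μ, hμ⟩ : ∃ μ : Fin 3 → ℕ → ℕ → HZ,
      ∀ i j k, μ i j k = if n i = 1 then 0 else lam i j k := ⟨_, fun _ _ _ => rfl⟩
  have hdhat : ∀ i j k,
      dhat i j k = (1 / (n i : ℚ)) • h (dm i j) + (μ i j k - μ i (j + 1) k) := by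
    intro i j k
    rw [hdhatdef, hμ, hμ]
    split_ifs with h1
    · simp [h1]
    · rfl
  have hμW : ∀ i j k x, 1 ≤ j → j ≤ γ i → k ≤ n i - 1 → BZ (h x) (μ i j k) = 0 := by
    intro i j k x hj hj' hk
    rw [hμ]
    split_ifs with h1
    · simp
    · exact hlamW i (by have := hn i; omega) j k hj hj' hk x
  have hμW' : ∀ i j k x, 1 ≤ j → j ≤ γ i → k ≤ n i - 1 → BZ (μ i j k) (h x) = 0 :=
    fun i j k x hj hj' hk => (hBZsymm _ _).trans (hμW i j k x hj hj' hk)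
  have hμself : ∀ i j k, 1 ≤ j → j ≤ γ i → k ≤ n i - 1 →
      BZ (μ i j k) (μ i j k) = 1 / (n i : ℚ) - 1 := by
    intro i j k hj hj' hk
    rw [hμ]
    split_ifs with h1
    · simp [h1]
    · rw [hlamself i (by have := hn i; omega) j hj hj' k hk]
      have := hn0 i
      field_simp
      ring
  have hμne : ∀ i j k k', 1 ≤ j → j ≤ γ i → k ≤ n i - 1 → k' ≤ n i - 1 → k ≠ k' →
      BZ (μ i j k) (μ i j k') = 1 / (n i : ℚ) := by
    intro i j k k' hj hj' hk hk' hne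
    have h1 : n i ≠ 1 := by omega
    rw [hμ, hμ, if_neg h1, if_neg h1]
    exact hlamkk' i (by omega) j hj hj' k k' hk hk' hne
  have hμorth : ∀ i i' j j' k k', 1 ≤ j → j ≤ γ i → 1 ≤ j' → j' ≤ γ i' →
      k ≤ n i - 1 → k' ≤ n i' - 1 → (i ≠ i' ∨ j ≠ j') →
      BZ (μ i j k) (μ i' j' k') = 0 := by
    intro i i' j j' k k' hj1 hj2 hj1' hj2' hk hk' hne
    rw [hμ, hμ]
    split_ifs with h1 h2 h2
    · simp
    · simp
    · simp
    · refine hlamorth i i' (by have := hn i; omega) (by have := hn i'; omega) j j' k k'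
        hj1 hj2 hj1' hj2' hk hk' ?_
      rw [Ne, Prod.mk.injEq]
      tauto
  have hpair : ∀ i i' j j' k k', 1 ≤ j → j ≤ γ i - 1 → 1 ≤ j' → j' ≤ γ i' - 1 →
      k ≤ n i - 1 → k' ≤ n i' - 1 →
      BZ (dhat i j k) (dhat i' j' k') =
        1 / (n i : ℚ) * (1 / (n i' : ℚ)) * BW (dm i j) (dm i' j')
          + (BZ (μ i j k) (μ i' j' k') - BZ (μ i j k) (μ i' (j' + 1) k')
            - BZ (μ i (j + 1) k) (μ i' j' k')
            + BZ (μ i (j + 1) k) (μ i' (j' + 1) k')) := by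
    intro i i' j j' k k' hj1 hj2 hj1' hj2' hk hk'
    rw [hdhat, hdhat]
    simp only [map_add, map_sub, map_smul, LinearMap.add_apply, LinearMap.sub_apply,
      LinearMap.smul_apply, smul_eq_mul, hiso]
    rw [hμW i' j' k' _ hj1' (by omega) hk', hμW i' (j' + 1) k' _ (by omega) (by omega) hk',
      hμW' i j k _ hj1 (by omega) hk, hμW' i (j + 1) k _ (by omega) (by omega) hk]
    ring
  have hpair1 : ∀ i j k, 1 ≤ j → j ≤ γ i - 1 → k ≤ n i - 1 →
      BZ dhat1 (dhat i j k) = 1 / (n i : ℚ) * BW d1 (dm i j) := by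
    intro i j k hj1 hj2 hk
    rw [hdhat1, hdhat]
    simp only [map_add, map_sub, map_smul, smul_eq_mul, hiso]
    rw [hμW i j k _ hj1 (by omega) hk, hμW i (j + 1) k _ (by omega) (by omega) hk]
    ring
  have hadj0 : ∀ i j k k', 1 ≤ j → j + 1 ≤ γ i - 1 → k ≤ n i - 1 → k' ≤ n i - 1 → k ≠ k' →
      BZ (dhat i j k) (dhat i (j + 1) k') = 0 := by
    intro i j k k' hj1 hj2 hk hk' hne
    rw [hpair i i j (j + 1) k k' hj1 (by omega) (by omega) hj2 hk hk', hadj i j hj1 hj2,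
      hμorth i i j (j + 1) k k' hj1 (by omega) (by omega) (by omega) hk hk' (by omega),
      hμorth i i j (j + 1 + 1) k k' hj1 (by omega) (by omega) (by omega) hk hk' (by omega),
      hμne i (j + 1) k k' (by omega) (by omega) hk hk' hne,
      hμorth i i (j + 1) (j + 1 + 1) k k' (by omega) (by omega) (by omega) (by omega) hk hk'
        (by omega)]
    have := hn0 i
    field_simp
    ring
  refine ⟨by rw [hdhat1, hiso, hd11], ?_, ?_, ?_, ?_, ?_⟩
  · intro i j k hj1 hj2 hk
    rw [hpair i i j j k k hj1 hj2 hj1 hj2 hk hk, hdmm i j hj1 hj2,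
      hμself i j k hj1 (by omega) hk, hμself i (j + 1) k (by omega) (by omega) hk,
      hμorth i i j (j + 1) k k hj1 (by omega) (by omega) (by omega) hk hk (by omega),
      hμorth i i (j + 1) j k k (by omega) (by omega) hj1 (by omega) hk hk (by omega)]
    have := hn0 i
    field_simp
    ring
  · intro i k hi hk
    rw [hpair1 i 1 k le_rfl hi hk, hd1m1 i hi]
    exact one_div_mul_cancel (hn0 i)
  · intro i j k hj1 hj2 hk
    rw [hpair i i j (j + 1) k k hj1 (by omega) (by omega) hj2 hk hk, hadj i j hj1 hj2,
      hμorth i i j (j + 1) k k hj1 (by omega) (by omega) (by omega) hk hk (by omega),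
      hμorth i i j (j + 1 + 1) k k hj1 (by omega) (by omega) (by omega) hk hk (by omega),
      hμself i (j + 1) k (by omega) (by omega) hk,
      hμorth i i (j + 1) (j + 1 + 1) k k (by omega) (by omega) (by omega) (by omega) hk hk
        (by omega)]
    have := hn0 i
    field_simp
    ring
  · intro i j k hj1 hj2 hk
    rw [hpair1 i j k (by omega) hj2 hk, hd1m0 i j hj1 hj2, mul_zero]
  · intro i i' j j' k k' hj1 hj2 hj1' hj2' hk hk' hne hnadj
    by_cases hfar : i ≠ i' ∨ j + 2 ≤ j' ∨ j' + 2 ≤ j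
    · rw [hpair i i' j j' k k' hj1 hj2 hj1' hj2' hk hk',
        hoth i i' j j' hj1 hj2 hj1' hj2' hfar,
        hμorth i i' j j' k k' hj1 (by omega) hj1' (by omega) hk hk' (by omega),
        hμorth i i' j (j' + 1) k k' hj1 (by omega) (by omega) (by omega) hk hk' (by omega),
        hμorth i i' (j + 1) j' k k' (by omega) (by omega) hj1' (by omega) hk hk' (by omega),
        hμorth i i' (j + 1) (j' + 1) k k' (by omega) (by omega) (by omega) (by omega) hk hk'
          (by omega)]
      ring
    · obtain ⟨rfl, hclose⟩ : i = i' ∧ (j = j' ∨ j + 1 = j' ∨ j' + 1 = j) := by omega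
      have hkne : k ≠ k' := by
        rintro rfl
        omega
      rcases hclose with rfl | rfl | rfl
      · rw [hpair i i j j k k' hj1 hj2 hj1 hj2 hk hk', hdmm i j hj1 hj2,
          hμne i j k k' hj1 (by omega) hk hk' hkne,
          hμne i (j + 1) k k' (by omega) (by omega) hk hk' hkne,
          hμorth i i j (j + 1) k k' hj1 (by omega) (by omega) (by omega) hk hk' (by omega),
          hμorth i i (j + 1) j k k' (by omega) (by omega) hj1 (by omega) hk hk' (by omega)]
        have := hn0 i
        field_simp
        ring
      · exact hadj0 i j k k' hj1 hj2' hk hk' hkne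
      · rw [hBZsymm]
        exact hadj0 i j' k' k hj1' hj2 hk' hk hkne.symm
end
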